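/- arXiv:2403.01880 — 5 statements merged into one kernel-verified Lean document; each statement's English description precedes it below -/
import Mathlib

section
/- Assume the continuum hypothesis 2^ℵ₀ = ℵ₁ and also 2^ℵ₁ = ℵ₂. Then there exists a topological space Y such that: Y is regular Hausdorff (T3); Y is a P-space (every Gδ subset of Y is open); and Y is not weakly discretely generated, i.e., there exists a non-closed subset A ⊆ Y such that for every subset D ⊆ A that is discrete in its subspace topology, the closure of D in Y is contained in A. -/
open Set Cardinal Topology

/-- The type of countable subsets of `W`. -/
abbrev CountableSubset (W : Type) : Type := {t : Set W // t.Countable}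

namespace CountableSubset

variable {W : Type}

/-- A cylinder: all countable sets with a prescribed trace on some countable set. -/
def IsCylinder (B : Set (CountableSubset W)) : Prop :=
  ∃ a : CountableSubset W, ∃ K : Set W, K.Countable ∧ B = {b | b.1 ∩ K = a.1 ∩ K}

theorem IsCylinder.nonempty {B : Set (CountableSubset W)} (hB : IsCylinder B) : B.Nonempty := by
  obtain ⟨a, K, -, rfl⟩ := hB
  exact ⟨a, rfl⟩

/-- A countable family of pairwise intersecting cylinders has a common refinement. -/
theorem exists_isCylinder_subset {F : Set (Set (CountableSubset W))} (hF : F.Countable)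
    (hcyl : ∀ B ∈ F, IsCylinder B) (hmeet : ∀ B ∈ F, ∀ B' ∈ F, (B ∩ B').Nonempty) :
    ∃ B, IsCylinder B ∧ ∀ B' ∈ F, B ⊆ B' := by
  have : Nonempty (CountableSubset W) := ⟨⟨∅, countable_empty⟩⟩
  choose! a K hK hB using hcyl
  refine ⟨_, ⟨⟨⋃ B ∈ F, (a B).1 ∩ K B, hF.biUnion fun B _ => (a B).2.mono inter_subset_left⟩,
    ⋃ B ∈ F, K B, hF.biUnion hK, rfl⟩, ?_⟩
  intro B hBF b hb
  rw [hB B hBF]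
  ext w
  have hbw := Set.ext_iff.1 hb w
  simp only [mem_inter_iff, mem_iUnion] at hbw ⊢
  constructor
  · rintro ⟨hw, hwK⟩
    obtain ⟨⟨B', hB', hw', hwK'⟩, -⟩ := hbw.1 ⟨hw, B, hBF, hwK⟩
    obtain ⟨c, hc, hc'⟩ := hmeet B hBF B' hB'
    rw [hB B hBF] at hc
    rw [hB B' hB'] at hc'
    have h1 := (Set.ext_iff.1 hc w)
    have h2 := (Set.ext_iff.1 hc' w)
    simp only [mem_inter_iff] at h1 h2
    tauto
  · rintro ⟨hw, hwK⟩
    exact ⟨(hbw.2 ⟨⟨B, hBF, hw, hwK⟩, B, hBF, hwK⟩).1, hwK⟩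

/-- Two points agree on `K` if they lie in the same piece and have the same trace on `K`. -/
def Agree (K : Set W) (x y : CountableSubset W × CountableSubset W) : Prop :=
  x.1 = y.1 ∧ x.2.1 ∩ K = y.2.1 ∩ K

theorem Agree.refl (K : Set W) (x : CountableSubset W × CountableSubset W) : Agree K x x :=
  ⟨rfl, rfl⟩

theorem Agree.symm {K : Set W} {x y : CountableSubset W × CountableSubset W}
    (h : Agree K x y) : Agree K y x :=
  ⟨h.1.symm, h.2.symm⟩

theorem Agree.trans {K : Set W} {x y z : CountableSubset W × CountableSubset W}
    (h : Agree K x y) (h' : Agree K y z) : Agree K x z :=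
  ⟨h.1.trans h'.1, h.2.trans h'.2⟩

theorem Agree.mono {K K' : Set W} {x y : CountableSubset W × CountableSubset W}
    (h : Agree K' x y) (hK : K ⊆ K') : Agree K x y := by
  refine ⟨h.1, ?_⟩
  rw [← inter_eq_self_of_subset_right hK, ← inter_assoc, ← inter_assoc, h.2]

/-- Every point of `D` is isolated in `D` by a cylinder. -/
def IsolatedByCylinders (D : Set (CountableSubset W × CountableSubset W)) : Prop :=
  ∀ d ∈ D, ∃ K : Set W, K.Countable ∧ ∀ y ∈ D, Agree K y d → y = d

theorem isolatedByCylinders_singleton (x : CountableSubset W × CountableSubset W) :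
    IsolatedByCylinders {x} :=
  fun d hd => ⟨∅, countable_empty, fun y hy _ => by rw [hy, hd]⟩

/-- Cylinder-isolated sets are nowhere dense in each piece. -/
theorem exists_isCylinder_subset_disjoint [Uncountable W]
    {D : Set (CountableSubset W × CountableSubset W)} (hD : IsolatedByCylinders D)
    (γ : CountableSubset W) {B : Set (CountableSubset W)} (hB : IsCylinder B) :
    ∃ B', IsCylinder B' ∧ B' ⊆ B ∧ ∀ b ∈ B', (γ, b) ∉ D := by
  by_cases hmiss : ∀ b ∈ B, (γ, b) ∉ D
  · exact ⟨B, hB, subset_rfl, hmiss⟩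
  push Not at hmiss
  obtain ⟨b, hb, hbD⟩ := hmiss
  obtain ⟨a, K, hK, rfl⟩ := hB
  obtain ⟨L, hL, hLD⟩ := hD _ hbD
  have hKL : (K ∪ L).Countable := hK.union hL
  obtain ⟨w, hw⟩ : ∃ w, w ∉ K ∪ L := by
    by_contra! h
    exact not_countable_univ (hKL.mono fun w _ => h w)
  obtain ⟨b', hb'w, hb'⟩ : ∃ b' : CountableSubset W, ¬ (w ∈ b'.1 ↔ w ∈ b.1) ∧
      ∀ v, v ≠ w → (v ∈ b'.1 ↔ v ∈ b.1) := by
    by_cases hwb : w ∈ b.1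
    · exact ⟨⟨b.1 \ {w}, b.2.mono sdiff_subset⟩, by simp [hwb], fun v hv => by simp [hv]⟩
    · exact ⟨⟨insert w b.1, b.2.insert w⟩, by simp [hwb], fun v hv => by simp [hv]⟩
  have key : ∀ c : CountableSubset W, c.1 ∩ insert w (K ∪ L) = b'.1 ∩ insert w (K ∪ L) →
      (¬ (w ∈ c.1 ↔ w ∈ b.1)) ∧ ∀ v ∈ K ∪ L, (v ∈ c.1 ↔ v ∈ b.1) := by
    intro c hc
    have hc' : ∀ v ∈ insert w (K ∪ L), (v ∈ c.1 ↔ v ∈ b'.1) := by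
      intro v hv
      have := Set.ext_iff.1 hc v
      simp only [mem_inter_iff, hv, and_true] at this
      exact this
    refine ⟨by rwa [hc' w (mem_insert _ _)], fun v hv => ?_⟩
    rw [hc' v (mem_insert_of_mem _ hv), hb' v (by rintro rfl; exact hw hv)]
  refine ⟨_, ⟨b', insert w (K ∪ L), hKL.insert w, rfl⟩, ?_, ?_⟩
  · intro c hc
    have hcK : c.1 ∩ K = b.1 ∩ K := by
      ext v
      have := (key c hc).2 v
      simp only [mem_inter_iff, mem_union] at this ⊢
      tauto
    exact hcK.trans hb
  · intro c hc hcD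
    have : (γ, c) = (γ, b) := hLD _ hcD ⟨rfl, by
      ext v
      have := (key c hc).2 v
      simp only [mem_inter_iff, mem_union] at this ⊢
      tauto⟩
    have hcb : c = b := congrArg Prod.snd this
    exact (key c hc).1 (by rw [hcb])

theorem exists_isCylinder_disjoint_refining [Uncountable W]
    {D : Set (CountableSubset W × CountableSubset W)} (hD : IsolatedByCylinders D)
    (γ : CountableSubset W) (F : Set (Set (CountableSubset W))) :
    ∃ B, IsCylinder B ∧ (∀ b ∈ B, (γ, b) ∉ D) ∧
      ((∃ B', IsCylinder B' ∧ ∀ A ∈ F, B' ⊆ A) → ∀ A ∈ F, B ⊆ A) := by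
  by_cases h : ∃ B', IsCylinder B' ∧ ∀ A ∈ F, B' ⊆ A
  · obtain ⟨B', hB', hB'F⟩ := h
    obtain ⟨B, hB, hBB', hBD⟩ := exists_isCylinder_subset_disjoint hD γ hB'
    exact ⟨B, hB, hBD, fun _ A hA => hBB'.trans (hB'F A hA)⟩
  · obtain ⟨B, hB, -, hBD⟩ := exists_isCylinder_subset_disjoint hD γ
      (B := {b | b.1 ∩ ∅ = (∅ : Set W) ∩ ∅}) ⟨⟨∅, countable_empty⟩, ∅, countable_empty, rfl⟩
    exact ⟨B, hB, hBD, fun h' => absurd h' h⟩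

end CountableSubset

/-- Given injections `g ξ` of the initial segments of `I` into `W`, every countable subset of `I`
extends to a countable `S` whose traces on the initial segments `Iio ξ`, `ξ ∈ S`, are all decoded
from one countable subset of `W`. -/
theorem exists_countable_coherent {I W : Type} [LT I] (g : I → I → W)
    (hg : ∀ ξ, InjOn (g ξ) {η | η < ξ}) {C : Set I} (hC : C.Countable) :
    ∃ γ : Set W, γ.Countable ∧ ∃ S : Set I, S.Countable ∧ C ⊆ S ∧
      ∀ ξ ∈ S, ∀ η < ξ, (g ξ η ∈ γ ↔ η ∈ S) := by
  let next : Set I → Set I := fun S => S ∪ ⋃ ξ ∈ S, {η | η < ξ ∧ g ξ η ∈ image2 g S S}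
  let S : ℕ → Set I := fun n => next^[n] C
  have hsucc : ∀ n, S (n + 1) = next (S n) := fun n => Function.iterate_succ_apply' next n C
  have hmono : Monotone S := monotone_nat_of_le_succ fun n => by
    rw [hsucc]; exact subset_union_left
  have hcount : ∀ n, (S n).Countable := by
    intro n
    induction n with
    | zero => exact hC
    | succ n ih =>
      rw [hsucc]
      refine ih.union (ih.biUnion fun ξ _ => ?_)
      exact MapsTo.countable_of_injOn (f := g ξ) (fun η hη => hη.2)
        ((hg ξ).mono fun η hη => hη.1) (ih.image2 ih g)
  have hScount : (⋃ n, S n).Countable := countable_iUnion hcount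
  refine ⟨image2 g (⋃ n, S n) (⋃ n, S n), hScount.image2 hScount g, ⋃ n, S n, hScount,
    subset_iUnion S 0, fun ξ hξ η hη => ⟨?_, fun h => mem_image2_of_mem hξ h⟩⟩
  rintro ⟨ξ', hξ', η', hη', heq⟩
  obtain ⟨i, hi⟩ := mem_iUnion.1 hξ
  obtain ⟨j, hj⟩ := mem_iUnion.1 hξ'
  obtain ⟨k, hk⟩ := mem_iUnion.1 hη'
  let n := max i (max j k)
  refine mem_iUnion.2 ⟨n + 1, ?_⟩
  rw [hsucc]
  refine Or.inr (mem_biUnion (hmono (le_max_left _ _) hi) ⟨hη, ?_⟩)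
  rw [← heq]
  exact mem_image2_of_mem (hmono ((le_max_left _ _).trans (le_max_right i _)) hj)
    (hmono ((le_max_right _ _).trans (le_max_right i _)) hk)

namespace CountableSubset

variable {W : Type}

/-- If the family of cylinder-isolated sets is enumerated by a well-order all of whose initial
segments inject into `W`, then these sets can be separated by clopen sets from
a countably complete filter. -/
theorem exists_clopen_separating_family [Uncountable W] {I : Type} [LinearOrder I]
    [WellFoundedLT I] (D : I → Set (CountableSubset W × CountableSubset W))
    (hD : ∀ ξ, IsolatedByCylinders (D ξ)) (g : I → I → W)
    (hg : ∀ ξ, InjOn (g ξ) {η | η < ξ}) :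
    ∃ U : I → Set (CountableSubset W × CountableSubset W),
      (∀ ξ x, ∃ K : Set W, K.Countable ∧ ∀ y, Agree K y x → (y ∈ U ξ ↔ x ∈ U ξ)) ∧
      (∀ ξ, ∀ x ∈ U ξ, x ∉ D ξ) ∧
      ∀ C : Set I, C.Countable → ∃ x, ∀ ξ ∈ C, x ∈ U ξ := by
  choose next hcyl hmiss hrefine using fun (γ : CountableSubset W) (ξ : I) =>
    exists_isCylinder_disjoint_refining (hD ξ) γ
  let T : CountableSubset W → I → Set (CountableSubset W) := fun γ =>
    wellFounded_lt.fix fun ξ ih => next γ ξ {A | ∃ η, ∃ h : η < ξ, g ξ η ∈ γ.1 ∧ A = ih η h}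
  have hT : ∀ γ ξ, T γ ξ = next γ ξ {A | ∃ η, ∃ _ : η < ξ, g ξ η ∈ γ.1 ∧ A = T γ η} :=
    fun γ ξ => wellFounded_lt.fix_eq _ ξ
  have hTcyl : ∀ γ ξ, IsCylinder (T γ ξ) := fun γ ξ => by rw [hT]; exact hcyl _ _ _
  refine ⟨fun ξ => {x | x.2 ∈ T x.1 ξ}, ?_, ?_, ?_⟩
  · rintro ξ ⟨γ, b⟩
    obtain ⟨a, K, hK, hB⟩ := hTcyl γ ξ
    refine ⟨K, hK, ?_⟩
    rintro ⟨γ', c⟩ ⟨h1, h2⟩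
    obtain rfl : γ' = γ := h1
    replace h2 : c.1 ∩ K = b.1 ∩ K := h2
    simp only [mem_ofPred_eq, hB, h2]
  · rintro ξ ⟨γ, b⟩ hb
    replace hb : b ∈ T γ ξ := hb
    rw [hT] at hb
    exact hmiss γ ξ _ b hb
  · intro C hC
    obtain ⟨γ, hγ, S, hS, hCS, hcoh⟩ := exists_countable_coherent g hg hC
    have hchain : ∀ ξ ∈ S, ∀ η ∈ S, η < ξ → T ⟨γ, hγ⟩ ξ ⊆ T ⟨γ, hγ⟩ η := by
      intro ξ
      induction ξ using WellFoundedLT.induction with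
      | ind ξ ih =>
        intro hξ η hη hlt
        rw [hT _ ξ]
        refine hrefine ⟨γ, hγ⟩ ξ _ ?_ _ ⟨η, hlt, (hcoh ξ hξ η hlt).2 hη, rfl⟩
        refine exists_isCylinder_subset ?_ ?_ ?_
        · refine (hS.image (T ⟨γ, hγ⟩)).mono ?_
          rintro A ⟨η', h, hgη, rfl⟩
          exact mem_image_of_mem _ ((hcoh ξ hξ η' h).1 hgη)
        · rintro A ⟨η', h, hgη, rfl⟩
          exact hTcyl _ _
        · rintro A ⟨η₁, h₁, hg₁, rfl⟩ A' ⟨η₂, h₂, hg₂, rfl⟩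
          have hm₁ := (hcoh ξ hξ η₁ h₁).1 hg₁
          have hm₂ := (hcoh ξ hξ η₂ h₂).1 hg₂
          rcases lt_trichotomy η₁ η₂ with h | h | h
          · rw [inter_eq_self_of_subset_right (ih η₂ h₂ hm₂ η₁ hm₁ h)]
            exact (hTcyl _ _).nonempty
          · rw [h, inter_self]
            exact (hTcyl _ _).nonempty
          · rw [inter_eq_self_of_subset_left (ih η₁ h₁ hm₁ η₂ hm₂ h)]
            exact (hTcyl _ _).nonempty
    obtain ⟨B, hB, hBS⟩ := exists_isCylinder_subset (hS.image (T ⟨γ, hγ⟩))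
      (by rintro A ⟨η, -, rfl⟩; exact hTcyl _ _) (by
        rintro A ⟨η₁, hm₁, rfl⟩ A' ⟨η₂, hm₂, rfl⟩
        rcases lt_trichotomy η₁ η₂ with h | h | h
        · rw [inter_eq_self_of_subset_right (hchain η₂ hm₂ η₁ hm₁ h)]
          exact (hTcyl _ _).nonempty
        · rw [h, inter_self]
          exact (hTcyl _ _).nonempty
        · rw [inter_eq_self_of_subset_left (hchain η₁ hm₁ η₂ hm₂ h)]
          exact (hTcyl _ _).nonempty)
    obtain ⟨b, hb⟩ := hB.nonempty
    exact ⟨(⟨γ, hγ⟩, b), fun ξ hξ => hBS _ (mem_image_of_mem _ (hCS hξ)) hb⟩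

/-- The one-point extension of the space of pairs of countable sets in which the neighbourhoods
of the new point are generated by countable intersections of the sets `U ξ`. -/
abbrev extensionTopology {I : Type} (U : I → Set (CountableSubset W × CountableSubset W)) :
    TopologicalSpace (Option (CountableSubset W × CountableSubset W)) where
  IsOpen s := (∀ x, some x ∈ s → ∃ K : Set W, K.Countable ∧ ∀ y, Agree K y x → some y ∈ s) ∧
    (none ∈ s → ∃ C : Set I, C.Countable ∧ ∀ y, (∀ ξ ∈ C, y ∈ U ξ) → some y ∈ s)
  isOpen_univ := ⟨fun _ _ => ⟨∅, countable_empty, fun _ _ => mem_univ _⟩,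
    fun _ => ⟨∅, countable_empty, fun _ _ => mem_univ _⟩⟩
  isOpen_inter := by
    rintro s t ⟨hs, hs'⟩ ⟨ht, ht'⟩
    refine ⟨fun x hx => ?_, fun hx => ?_⟩
    · obtain ⟨K, hK, h⟩ := hs x hx.1
      obtain ⟨L, hL, h'⟩ := ht x hx.2
      exact ⟨K ∪ L, hK.union hL, fun y hy =>
        ⟨h y (hy.mono subset_union_left), h' y (hy.mono subset_union_right)⟩⟩
    · obtain ⟨K, hK, h⟩ := hs' hx.1
      obtain ⟨L, hL, h'⟩ := ht' hx.2
      exact ⟨K ∪ L, hK.union hL, fun y hy =>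
        ⟨h y fun ξ hξ => hy ξ (Or.inl hξ), h' y fun ξ hξ => hy ξ (Or.inr hξ)⟩⟩
  isOpen_sUnion := by
    intro T hT
    refine ⟨?_, ?_⟩
    · rintro x ⟨s, hs, hx⟩
      obtain ⟨K, hK, h⟩ := (hT s hs).1 x hx
      exact ⟨K, hK, fun y hy => ⟨s, hs, h y hy⟩⟩
    · rintro ⟨s, hs, hx⟩
      obtain ⟨K, hK, h⟩ := (hT s hs).2 hx
      exact ⟨K, hK, fun y hy => ⟨s, hs, h y hy⟩⟩

section Extension

variable {I : Type} {U : I → Set (CountableSubset W × CountableSubset W)}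

theorem isOpen_of_isGδ_extension (s : Set (Option (CountableSubset W × CountableSubset W)))
    (hs : @IsGδ _ (extensionTopology U) s) : @IsOpen _ (extensionTopology U) s := by
  obtain ⟨T, hT, hTc, rfl⟩ := hs
  refine ⟨fun x hx => ?_, fun hx => ?_⟩
  · choose! K hK h using fun t ht => (hT t ht).1 x (hx t ht)
    exact ⟨⋃ t ∈ T, K t, hTc.biUnion hK, fun y hy t ht =>
      h t ht y (hy.mono (subset_biUnion_of_mem ht))⟩
  · choose! C hC h using fun t ht => (hT t ht).2 (hx t ht)
    exact ⟨⋃ t ∈ T, C t, hTc.biUnion hC, fun y hy t ht =>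
      h t ht y fun ξ hξ => hy ξ (mem_biUnion ht hξ)⟩

/-- A common trace set witnessing that countably many of the sets `U ξ` are clopen. -/
theorem exists_agree_forall_mem_iff
    (hU : ∀ ξ x, ∃ K : Set W, K.Countable ∧ ∀ y, Agree K y x → (y ∈ U ξ ↔ x ∈ U ξ))
    {C : Set I} (hC : C.Countable) (x : CountableSubset W × CountableSubset W) :
    ∃ K : Set W, K.Countable ∧ ∀ y, Agree K y x → ∀ ξ ∈ C, (y ∈ U ξ ↔ x ∈ U ξ) := by
  choose K hK h using fun ξ => hU ξ x
  exact ⟨⋃ ξ ∈ C, K ξ, hC.biUnion fun ξ _ => hK ξ, fun y hy ξ hξ =>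
    h ξ y (hy.mono (subset_biUnion_of_mem hξ))⟩

/-- The basic neighbourhoods of the new point. -/
theorem isClopen_extension_none
    (hU : ∀ ξ x, ∃ K : Set W, K.Countable ∧ ∀ y, Agree K y x → (y ∈ U ξ ↔ x ∈ U ξ))
    {C : Set I} (hC : C.Countable) :
    @IsClopen _ (extensionTopology U) {z | ∀ x, z = some x → ∀ ξ ∈ C, x ∈ U ξ} := by
  let := extensionTopology U
  refine ⟨⟨?_⟩, ?_⟩
  · refine ⟨fun x hx => ?_, fun hx => (hx (by simp)).elim⟩
    obtain ⟨K, hK, h⟩ := exists_agree_forall_mem_iff hU hC x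
    refine ⟨K, hK, fun y hy hy' => hx ?_⟩
    intro x' hx' ξ hξ
    obtain rfl := Option.some_injective _ hx'
    exact (h y hy ξ hξ).1 (hy' y rfl ξ hξ)
  · refine ⟨fun x hx => ?_, fun _ => ⟨C, hC, ?_⟩⟩
    · obtain ⟨K, hK, h⟩ := exists_agree_forall_mem_iff hU hC x
      refine ⟨K, hK, ?_⟩
      intro y hy y' hy' ξ hξ
      obtain rfl := Option.some_injective _ hy'
      exact (h y hy ξ hξ).2 (hx x rfl ξ hξ)
    · intro y hy y' hy'
      obtain rfl := Option.some_injective _ hy'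
      exact hy

/-- The basic neighbourhoods of the old points. -/
theorem isClopen_extension_some
    (hU : ∀ ξ x, ∃ K : Set W, K.Countable ∧ ∀ y, Agree K y x → (y ∈ U ξ ↔ x ∈ U ξ))
    {K : Set W} (hK : K.Countable) (x : CountableSubset W × CountableSubset W) (ξ : I) :
    @IsClopen _ (extensionTopology U) (some '' {y | Agree K y x ∧ y ∉ U ξ}) := by
  let := extensionTopology U
  have hloc : ∀ y, ∃ L : Set W, L.Countable ∧ ∀ z, Agree L z y →
      ((Agree K z x ∧ z ∉ U ξ) ↔ (Agree K y x ∧ y ∉ U ξ)) := by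
    intro y
    obtain ⟨L, hL, h⟩ := hU ξ y
    refine ⟨K ∪ L, hK.union hL, fun z hz => ?_⟩
    have hzK := hz.mono (subset_union_left (s := K) (t := L))
    rw [h z (hz.mono subset_union_right)]
    exact and_congr_left fun _ => ⟨hzK.symm.trans, hzK.trans⟩
  refine ⟨⟨?_⟩, ?_⟩
  · refine ⟨fun y hy => ?_, fun _ => ⟨{ξ}, countable_singleton ξ, ?_⟩⟩
    · obtain ⟨L, hL, h⟩ := hloc y
      refine ⟨L, hL, fun z hz hz' => hy ?_⟩
      obtain ⟨z', hz', heq⟩ := hz'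
      obtain rfl := Option.some_injective _ heq
      exact ⟨y, (h _ hz).1 hz', rfl⟩
    · rintro y hy ⟨z, hz, heq⟩
      obtain rfl := Option.some_injective _ heq
      exact hz.2 (hy ξ rfl)
  · refine ⟨?_, by simp⟩
    rintro y ⟨y', hy', heq⟩
    obtain rfl := Option.some_injective _ heq
    obtain ⟨L, hL, h⟩ := hloc y'
    exact ⟨L, hL, fun z hz => ⟨z, (h z hz).2 hy', rfl⟩⟩

theorem t3Space_extension
    (hU : ∀ ξ x, ∃ K : Set W, K.Countable ∧ ∀ y, Agree K y x → (y ∈ U ξ ↔ x ∈ U ξ))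
    (hUx : ∀ x, ∃ ξ, x ∉ U ξ) : @T3Space _ (extensionTopology U) := by
  let := extensionTopology U
  have hsep : ∀ x (y : Option (CountableSubset W × CountableSubset W)),
      Inseparable (some x) y → some x = y := by
    intro x y hxy
    obtain ⟨ξ, hξ⟩ := hUx x
    have hmem : ∀ {K : Set W}, K.Countable → y ∈ some '' {y | Agree K y x ∧ y ∉ U ξ} :=
      fun hK => (hxy.mem_open_iff (isClopen_extension_some hU hK x ξ).2).1
        ⟨x, ⟨Agree.refl _ x, hξ⟩, rfl⟩
    obtain ⟨y, -, rfl⟩ := hmem countable_empty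
    obtain ⟨y', ⟨⟨h1, h2⟩, -⟩, heq⟩ := hmem (x.2.2.union y.2.2)
    obtain rfl := Option.some_injective _ heq
    rw [inter_eq_self_of_subset_left subset_union_right,
      inter_eq_self_of_subset_left subset_union_left] at h2
    exact congrArg some (Prod.ext h1.symm (Subtype.ext h2.symm))
  have : T0Space (Option (CountableSubset W × CountableSubset W)) := by
    refine ⟨fun x y hxy => ?_⟩
    cases x with
    | some x => exact hsep x y hxy
    | none =>
      cases y with
      | some y => exact (hsep y none hxy.symm).symm
      | none => rfl
  have : RegularSpace (Option (CountableSubset W × CountableSubset W)) := by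
    refine RegularSpace.of_exists_mem_nhds_isClosed_subset fun z s hs => ?_
    obtain ⟨t, hts, ht, hzt⟩ := mem_nhds_iff.1 hs
    cases z with
    | none =>
      obtain ⟨C, hC, h⟩ := ht.2 hzt
      have hclopen := isClopen_extension_none hU hC
      refine ⟨_, hclopen.2.mem_nhds (by simp), hclopen.1, ?_⟩
      intro z hz
      cases z with
      | none => exact hts hzt
      | some y => exact hts (h y (hz y rfl))
    | some x =>
      obtain ⟨K, hK, h⟩ := ht.1 x hzt
      obtain ⟨ξ, hξ⟩ := hUx x
      have hclopen := isClopen_extension_some hU hK x ξ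
      refine ⟨_, hclopen.2.mem_nhds ⟨x, ⟨Agree.refl _ x, hξ⟩, rfl⟩, hclopen.1, ?_⟩
      rintro _ ⟨y, hy, rfl⟩
      exact hts (h y hy.1)
  exact {}

/-- The traces of discrete subsets of the extension are isolated by cylinders. -/
theorem isolatedByCylinders_preimage_some
    {D : Set (Option (CountableSubset W × CountableSubset W))}
    (hD : @DiscreteTopology D (@instTopologicalSpaceSubtype _ _ (extensionTopology U))) :
    IsolatedByCylinders (some ⁻¹' D) := by
  let := extensionTopology U
  intro d hd
  obtain ⟨V, hV, hVD⟩ := discreteTopology_subtype_iff'.1 hD _ hd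
  obtain ⟨K, hK, h⟩ := hV.1 d (hVD.symm.subset rfl).1
  exact ⟨K, hK, fun y hy hyd => Option.some_injective _ (hVD.subset ⟨h y hyd, hy⟩)⟩

end Extension

theorem mk_prod_le (hW : #W = ℵ_ 1) (hCH : (2 : Cardinal.{0}) ^ ℵ_ 0 = ℵ_ 1) :
    #(CountableSubset W × CountableSubset W) ≤ ℵ_ 1 := by
  have h0 : ℵ₀ ≤ ℵ_ 1 := aleph0_le_aleph 1
  have h1 : #(CountableSubset W) ≤ ℵ_ 1 := by
    have h := mk_bounded_set_le W ℵ₀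
    simp only [le_aleph0_iff_set_countable, hW, max_eq_left h0] at h
    refine h.trans_eq ?_
    rw [← hCH, aleph_zero, ← power_mul, aleph0_mul_aleph0]
  rw [← mul_def]
  exact (mul_le_mul' h1 h1).trans_eq (mul_eq_self h0)

end CountableSubset

/-- Instances of the generalized continuum hypothesis descend to the lowest universe. -/
theorem two_power_aleph_of_lift.{u} {m n : ℕ}
    (h : (2 : Cardinal.{u}) ^ ℵ_ (m : Ordinal.{u}) = ℵ_ (n : Ordinal.{u})) :
    (2 : Cardinal.{0}) ^ ℵ_ (m : Ordinal.{0}) = ℵ_ (n : Ordinal.{0}) := by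
  apply lift_injective.{u, 0}
  simpa only [lift_power, lift_two, lift_aleph, Ordinal.lift_natCast] using h

open CountableSubset

/-- Assuming `2^ℵ₀ = ℵ₁` and `2^ℵ₁ = ℵ₂`, there is a regular Hausdorff (T3) P-space
(every Gδ set is open) which is not weakly discretely generated: some non-closed set
`A` contains the closure of each of its discrete subsets. -/
theorem exists_regular_Pspace_not_weakly_discretely_generated
    (hCH : (2 : Cardinal) ^ Cardinal.aleph 0 = Cardinal.aleph 1)
    (hCH1 : (2 : Cardinal) ^ Cardinal.aleph 1 = Cardinal.aleph 2) :
    ∃ (Y : Type) (_ : TopologicalSpace Y),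
      T3Space Y ∧
      (∀ s : Set Y, IsGδ s → IsOpen s) ∧
      (∃ A : Set Y, ¬ IsClosed A ∧
        ∀ D : Set Y, D ⊆ A → DiscreteTopology D → closure D ⊆ A) := by
  have hCH' : (2 : Cardinal.{0}) ^ ℵ_ 0 = ℵ_ 1 := by
    exact_mod_cast two_power_aleph_of_lift (m := 0) (n := 1) (by exact_mod_cast hCH)
  have hCH1' : (2 : Cardinal.{0}) ^ ℵ_ 1 = ℵ_ 2 := by
    exact_mod_cast two_power_aleph_of_lift (m := 1) (n := 2) (by exact_mod_cast hCH1)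
  obtain ⟨W, hW⟩ : ∃ W : Type, #W = ℵ_ 1 := ⟨_, mk_out _⟩
  have : Uncountable W := by
    rw [← aleph0_lt_mk_iff, hW]
    exact aleph0_lt_aleph_one
  obtain ⟨I, ⟨e⟩⟩ : ∃ I : Type, Nonempty
      (I ≃ {D : Set (CountableSubset W × CountableSubset W) // IsolatedByCylinders D}) :=
    ⟨_, ⟨Equiv.refl _⟩⟩
  have hI : #I ≤ ℵ_ 2 := by
    rw [mk_congr e]
    refine (mk_subtype_le _).trans ?_
    rw [mk_set, ← hCH1']
    exact power_le_power_left two_ne_zero (mk_prod_le hW hCH')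
  obtain ⟨_, _, hord⟩ := exists_ord_eq_type_lt I
  have hseg : ∀ ξ : I, #(Iio ξ) ≤ #W := by
    intro ξ
    have h := (mk_Iio_lt ξ hord).trans_le hI
    rwa [← one_add_one_eq_two, ← succ_aleph, Order.lt_succ_iff, ← hW] at h
  have hinj : ∀ ξ : I, ∃ g : I → W, InjOn g {η | η < ξ} := by
    intro ξ
    obtain ⟨f⟩ := hseg ξ
    classical
    refine ⟨fun η => if h : η < ξ then f ⟨η, h⟩ else Classical.arbitrary W, ?_⟩
    intro η hη η' hη' heq
    rw [mem_ofPred_eq] at hη hη'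
    simp only [hη, hη', dif_pos] at heq
    exact congrArg Subtype.val (f.injective heq)
  choose g hg using hinj
  obtain ⟨U, hU, hUD, hUC⟩ := exists_clopen_separating_family (fun ξ : I => (e ξ).1)
    (fun ξ => (e ξ).2) g hg
  refine ⟨_, extensionTopology U, ?_, isOpen_of_isGδ_extension, range some, ?_, ?_⟩
  · exact t3Space_extension hU fun x =>
      ⟨e.symm ⟨{x}, isolatedByCylinders_singleton x⟩, fun hx => hUD _ x hx (by simp)⟩
  · intro hclosed
    obtain ⟨C, hC, h⟩ := hclosed.isOpen_compl.2 (by simp)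
    obtain ⟨x, hx⟩ := hUC C hC
    exact h x hx ⟨x, rfl⟩
  · intro D hDA hDdisc z hz
    cases z with
    | some x => exact ⟨x, rfl⟩
    | none =>
      let := extensionTopology U
      obtain ⟨ξ, hξ⟩ := e.surjective ⟨_, isolatedByCylinders_preimage_some hDdisc⟩
      obtain ⟨y, hy, hyD⟩ := mem_closure_iff.1 hz _
        (isClopen_extension_none hU (countable_singleton ξ)).2 (by simp)
      cases y with
      | none => exact hDA hyD
      | some y => exact (hUD ξ y (hy y rfl ξ rfl) (by rw [hξ]; exact hyD)).elim
end

section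
/- Assume 2^ℵ₀ = ℵ₁ and 2^ℵ₁ = ℵ₂. Then there exists a topological space Y = X ∪ {∞}, where ∞ ∉ X, such that: Y is regular Hausdorff (T3); every Gδ subset of Y is open; the point ∞ is not isolated in Y; and ∞ does not belong to the closure in Y of any subset D ⊆ X that is discrete in its subspace topology. -/
open Set Cardinal Topology

/-- For a regular cardinal `c` there is a well-ordered type of cardinality `c` whose proper initial
segments are smaller than `c` and whose subsets smaller than `c` are strictly bounded. -/
theorem exists_wellOrder_of_isRegular {c : Cardinal.{0}} (hc : c.IsRegular) :
    ∃ (T : Type) (_ : LinearOrder T), WellFoundedLT T ∧ #T = c ∧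
      (∀ a : T, #(Iio a) < c) ∧ ∀ s : Set T, #s < c → ∃ a, ∀ b ∈ s, b < a := by
  have hIio : ∀ a : c.ord.ToType, #(Iio a) < c := fun a ↦ by
    simpa using Cardinal.mk_Iio_lt a (by simp)
  refine ⟨c.ord.ToType, inferInstance, inferInstance, mk_ord_toType c, hIio, fun s hs ↦ ?_⟩
  by_contra! h
  have hIic : ∀ a : c.ord.ToType, #(Iic a) < c := fun a ↦ by
    rw [← Iio_insert]
    exact (mk_insert_le).trans_lt (add_lt_of_lt hc.aleph0_le (hIio a)
      (one_lt_aleph0.trans_le hc.aleph0_le))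
  have huniv : (⋃ b ∈ s, Iic b) = Set.univ := eq_univ_of_forall fun a ↦ by
    obtain ⟨b, hb, hab⟩ := h a
    exact mem_biUnion hb hab
  have := (card_biUnion_lt_iff_forall_of_isRegular hc hs (t := fun b _ ↦ Iic b)).2
    fun b _ ↦ hIic b
  rw [huniv, mk_univ, mk_ord_toType] at this
  exact this.false

theorem aleph_two_isRegular : (ℵ_ 2).IsRegular := by
  have := isRegular_aleph_add_one 1
  rwa [one_add_one_eq_two] at this

theorem lt_aleph_one_iff_countable {α : Type} {s : Set α} : #s < ℵ₁ ↔ s.Countable := by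
  rw [← succ_aleph0, Order.lt_succ_iff, le_aleph0_iff_set_countable]

theorem lt_aleph_two_iff {c : Cardinal.{0}} : c < ℵ_ 2 ↔ c ≤ ℵ₁ := by
  rw [← one_add_one_eq_two, ← succ_aleph, Order.lt_succ_iff]

/-- Under CH, any operation assigning to countable sets countable sets has a closed set of
cardinality at most `ℵ₁`. -/
theorem exists_closed_set_of_countable_operation (hCH : (2 : Cardinal.{0}) ^ ℵ₀ = ℵ₁)
    {T : Type} (G : Set T → Set T) (hG : ∀ p, (G p).Countable) :
    ∃ C : Set T, #C ≤ ℵ₁ ∧ ∀ p ⊆ C, p.Countable → G p ⊆ C := by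
  obtain ⟨I, _, _, hI, hIio, hbdd⟩ := exists_wellOrder_of_isRegular isRegular_aleph_one
  have hreg := aleph_two_isRegular
  let c : I → Set T := wellFounded_lt.fix fun i ih ↦
    (⋃ j, ⋃ h : j < i, ih j h) ∪
      ⋃ p : {p : Set T // p ⊆ (⋃ j, ⋃ h : j < i, ih j h) ∧ #p ≤ ℵ₀}, G p
  have hc : ∀ i, c i = (⋃ j ∈ Iio i, c j) ∪
      ⋃ p : {p : Set T // p ⊆ (⋃ j ∈ Iio i, c j) ∧ #p ≤ ℵ₀}, G p :=
    fun i ↦ wellFounded_lt.fix_eq _ i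
  have hcard : ∀ i, #(c i) ≤ ℵ₁ := by
    intro i
    induction i using WellFoundedLT.induction with
    | ind i ih =>
      have hU : #(⋃ j ∈ Iio i, c j : Set T) ≤ ℵ₁ := by
        rw [← lt_aleph_two_iff]
        refine (card_biUnion_lt_iff_forall_of_isRegular hreg (t := fun j _ ↦ c j)
          (lt_aleph_two_iff.2 (hIio i).le)).2 fun j hj ↦ lt_aleph_two_iff.2 (ih j hj)
      have hP : #{p : Set T // p ⊆ (⋃ j ∈ Iio i, c j) ∧ #p ≤ ℵ₀} ≤ ℵ₁ := by
        refine (mk_bounded_subset_le _ ℵ₀).trans ?_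
        refine (power_le_power_right (max_le hU aleph0_lt_aleph_one.le)).trans ?_
        rw [← hCH, ← power_mul, aleph0_mul_aleph0]
      rw [hc]
      refine (mk_union_le _ _).trans (add_le_of_le aleph0_lt_aleph_one.le hU ?_)
      rw [← lt_aleph_two_iff]
      refine (card_iUnion_lt_iff_forall_of_isRegular hreg (lt_aleph_two_iff.2 hP)).2 fun p ↦ ?_
      exact lt_aleph_two_iff.2 ((hG p).le_aleph0.trans aleph0_lt_aleph_one.le)
  refine ⟨⋃ i, c i, ?_, fun p hp hpc ↦ ?_⟩
  · rw [← lt_aleph_two_iff]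
    exact (card_iUnion_lt_iff_forall_of_isRegular hreg (lt_aleph_two_iff.2 hI.le)).2
      fun i ↦ lt_aleph_two_iff.2 (hcard i)
  · have : Nonempty I := by
      rw [← mk_ne_zero_iff, hI]
      exact (aleph_pos 1).ne'
    choose! f hf using fun t (ht : t ∈ p) ↦ mem_iUnion.1 (hp ht)
    obtain ⟨i, hi⟩ := hbdd (f '' p) (lt_aleph_one_iff_countable.2 (hpc.image f))
    have hpi : p ⊆ ⋃ j ∈ Iio i, c j := fun t ht ↦
      mem_biUnion (hi _ (mem_image_of_mem f ht)) (hf t ht)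
    refine subset_trans ?_ (subset_iUnion c i)
    rw [hc]
    exact subset_union_of_subset_right
      (subset_iUnion (fun p : {p : Set T // p ⊆ (⋃ j ∈ Iio i, c j) ∧ #p ≤ ℵ₀} ↦ G p)
        ⟨p, hpi, hpc.le_aleph0⟩) _

section Literals

variable {κ : Type}

/-- The graph of `x : κ → Bool`, seen as a set of literals. -/
def literals (x : κ → Bool) : Set (κ × Bool) := {l | x l.1 = l.2}

/-- A set of literals is consistent if it is the graph of a partial function. -/
def Consistent (p : Set (κ × Bool)) : Prop := ∀ a, (a, true) ∈ p → (a, false) ∉ p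

theorem Consistent.mono {p q : Set (κ × Bool)} (hq : Consistent q) (h : p ⊆ q) : Consistent p :=
  fun a h₁ h₂ ↦ hq a (h h₁) (h h₂)

theorem consistent_literals (x : κ → Bool) : Consistent (literals x) := fun a h₁ h₂ ↦ by
  simp_all [literals]

theorem Consistent.exists_subset_literals {p : Set (κ × Bool)} (hp : Consistent p) :
    ∃ x, p ⊆ literals x := by
  classical
  refine ⟨fun a ↦ decide ((a, true) ∈ p), ?_⟩
  rintro ⟨a, _ | _⟩ h
  · simpa [literals] using fun h' ↦ hp a h' h
  · simpa [literals] using h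

/-- `x` decides the family `F` if it extends a member of `F` or has a countable part which is
incompatible with all members of `F`. -/
def Decides (x : κ → Bool) (F : Set (Set (κ × Bool))) : Prop :=
  (∃ e ∈ F, e ⊆ literals x) ∨
    ∃ p ⊆ literals x, p.Countable ∧ ∀ e ∈ F, ¬ Consistent (p ∪ e)

theorem consistent_union_biUnion {I : Type} [LinearOrder I] {p₀ : Set (κ × Bool)}
    (hc₀ : Consistent p₀) {p : I → Set (κ × Bool)} (h₀ : ∀ i, p₀ ⊆ p i) (hp : Monotone p)
    {S : Set I} (hS : ∀ i ∈ S, Consistent (p i)) : Consistent (p₀ ∪ ⋃ i ∈ S, p i) := by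
  intro a h₁ h₂
  simp only [mem_union, mem_iUnion, exists_prop] at h₁ h₂
  rcases h₁ with h₁ | ⟨i, hi, h₁⟩ <;> rcases h₂ with h₂ | ⟨j, hj, h₂⟩
  · exact hc₀ a h₁ h₂
  · exact hS j hj a (h₀ j h₁) h₂
  · exact hS i hi a h₁ (h₀ i h₂)
  · rcases le_total i j with h | h
    · exact hS j hj a (hp h h₁) h₂
    · exact hS i hi a h₁ (hp h h₂)

/-- Baire category for the poset of countable partial functions. -/
theorem exists_decides_of_wellOrder {I : Type} [LinearOrder I] [WellFoundedLT I]
    (hI : ∀ i : I, (Iio i).Countable) (F : I → Set (Set (κ × Bool)))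
    (hF : ∀ i, ∀ e ∈ F i, e.Countable) {p₀ : Set (κ × Bool)} (hp₀ : p₀.Countable)
    (hc₀ : Consistent p₀) :
    ∃ x, p₀ ⊆ literals x ∧ ∀ i, Decides x (F i) := by
  classical
  let step (i : I) (q : Set (κ × Bool)) : Set (κ × Bool) :=
    if h : ∃ e ∈ F i, Consistent (q ∪ e) then q ∪ h.choose else q
  have hstep_sub : ∀ i q, q ⊆ step i q := fun i q ↦ by
    unfold step; split_ifs
    exacts [subset_union_left, subset_rfl]
  have hstep_count : ∀ i q, q.Countable → (step i q).Countable := fun i q hq ↦ by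
    unfold step; split_ifs with h
    exacts [hq.union (hF i _ h.choose_spec.1), hq]
  have hstep_cons : ∀ i q, Consistent q → Consistent (step i q) := fun i q hq ↦ by
    unfold step; split_ifs with h
    exacts [h.choose_spec.2, hq]
  have hstep_dec : ∀ i q, (∃ e ∈ F i, e ⊆ step i q) ∨ ∀ e ∈ F i, ¬ Consistent (step i q ∪ e) :=
    fun i q ↦ by
      unfold step; split_ifs with h
      · exact .inl ⟨_, h.choose_spec.1, subset_union_right⟩
      · exact .inr fun e he hc ↦ h ⟨e, he, hc⟩
  let p : I → Set (κ × Bool) := wellFounded_lt.fix fun i ih ↦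
    step i (p₀ ∪ ⋃ j, ⋃ h : j < i, ih j h)
  have hp : ∀ i, p i = step i (p₀ ∪ ⋃ j ∈ Iio i, p j) := fun i ↦ wellFounded_lt.fix_eq _ i
  have hsub : ∀ i, p₀ ∪ ⋃ j ∈ Iio i, p j ⊆ p i := fun i ↦ by
    conv_rhs => rw [hp]
    exact hstep_sub _ _
  have h₀ : ∀ i, p₀ ⊆ p i := fun i ↦ subset_union_left.trans (hsub i)
  have hmono : Monotone p := fun j i hji ↦ by
    rcases hji.eq_or_lt with rfl | h
    · exact subset_rfl
    · exact (subset_biUnion_of_mem (u := p) (show j ∈ Iio i from h)).trans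
        (subset_union_right.trans (hsub i))
  have hcount : ∀ i, (p i).Countable := fun i ↦ by
    induction i using WellFoundedLT.induction with
    | ind i ih =>
      rw [hp]
      exact hstep_count _ _ (hp₀.union ((hI i).biUnion ih))
  have hcons : ∀ i, Consistent (p i) := fun i ↦ by
    induction i using WellFoundedLT.induction with
    | ind i ih =>
      rw [hp]
      exact hstep_cons _ _ (consistent_union_biUnion hc₀ h₀ hmono ih)
  obtain ⟨x, hx⟩ := (consistent_union_biUnion hc₀ h₀ hmono (S := Set.univ)
    fun i _ ↦ hcons i).exists_subset_literals
  have hpx : ∀ i, p i ⊆ literals x := fun i ↦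
    (subset_biUnion_of_mem (u := p) (mem_univ i)).trans (subset_union_right.trans hx)
  refine ⟨x, subset_union_left.trans hx, fun i ↦ ?_⟩
  have h := hstep_dec i (p₀ ∪ ⋃ j ∈ Iio i, p j)
  rw [← hp] at h
  rcases h with ⟨e, he, hep⟩ | h
  · exact .inl ⟨e, he, hep.trans (hpx i)⟩
  · exact .inr ⟨p i, hpx i, hcount i, h⟩

/-- `x` is supported below `β` and decides all families in the list `E` that are indexed and
supported below `β`. -/
def GenericBelow [LinearOrder κ] (E : κ → Set (Set (κ × Bool))) (β : κ) (x : κ → Bool) : Prop :=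
  (∀ a, β ≤ a → x a = false) ∧
    ∀ ξ < β, (∀ e ∈ E ξ, ∀ l ∈ e, l.1 < β) → Decides x (E ξ)

theorem exists_genericBelow [LinearOrder κ] {E : κ → Set (Set (κ × Bool))}
    (hE : ∀ ξ, ∀ e ∈ E ξ, e.Countable) {β : κ} (hβ : #(Iio β) ≤ ℵ₁) {b : Set κ}
    (hb : b.Countable) (hbβ : ∀ a ∈ b, a < β) :
    ∃ x, GenericBelow E β x ∧ ∀ a ∈ b, x a = true := by
  obtain ⟨I, _, _, hI, hIio, -⟩ := exists_wellOrder_of_isRegular isRegular_aleph_one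
  rw [← hI] at hβ
  obtain ⟨j⟩ := hβ
  let F : I → Set (Set (κ × Bool)) := Function.extend j (fun ξ ↦ E ξ) fun _ ↦ ∅
  have hFj : ∀ ξ, F (j ξ) = E ξ := fun ξ ↦ j.injective.extend_apply _ _ ξ
  have hF : ∀ i, ∀ e ∈ F i, e.Countable := fun i e he ↦ by
    by_cases hi : ∃ ξ, j ξ = i
    · obtain ⟨ξ, rfl⟩ := hi
      rw [hFj] at he
      exact hE ξ e he
    · simp [F, Function.extend_apply' _ _ _ hi] at he
  obtain ⟨x, hx, hdec⟩ := exists_decides_of_wellOrder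
    (fun i ↦ lt_aleph_one_iff_countable.1 (hIio i)) F hF
    (p₀ := (fun a ↦ (a, true)) '' b) (hb.image _) (fun a _ h ↦ by simp at h)
  have htrunc : ∀ l ∈ literals x, l.1 < β → l ∈ literals fun a ↦ x a && decide (a < β) :=
    fun l hl hlβ ↦ by simpa [literals, hlβ] using hl
  refine ⟨fun a ↦ x a && decide (a < β), ⟨fun a ha ↦ by simp [ha], fun ξ hξ hsupp ↦ ?_⟩,
    fun a ha ↦ ?_⟩
  · have h := hdec (j ⟨ξ, hξ⟩)
    rw [hFj] at h
    rcases h with ⟨e, he, hex⟩ | ⟨p, hpx, hp, h⟩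
    · exact .inl ⟨e, he, fun l hl ↦ htrunc l (hex hl) (hsupp e he l hl)⟩
    · refine .inr ⟨p ∩ {l | l.1 < β}, fun l hl ↦ htrunc l (hpx hl.1) hl.2,
        hp.mono inter_subset_left, fun e he hc ↦ h e he fun a h₁ h₂ ↦ ?_⟩
      have hce : Consistent e := hc.mono subset_union_right
      have hcp : Consistent p := (consistent_literals x).mono hpx
      rcases h₁ with h₁ | h₁ <;> rcases h₂ with h₂ | h₂
      · exact hcp a h₁ h₂
      · exact hc a (.inl ⟨h₁, hsupp e he (a, false) h₂⟩) (.inr h₂)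
      · exact hc a (.inr h₁) (.inl ⟨h₂, hsupp e he (a, true) h₁⟩)
      · exact hce a h₁ h₂
  · exact htrunc (a, true) (hx (mem_image_of_mem _ ha)) (hbβ a ha)

/-- Generic points whose supports are unbounded cannot be separated by countable
conditions. -/
theorem exists_ne_subset_literals [LinearOrder κ] (hCH : (2 : Cardinal.{0}) ^ ℵ₀ = ℵ₁)
    (hbdd : ∀ s : Set κ, #s ≤ ℵ₁ → ∃ a, ∀ b ∈ s, b < a)
    {E : κ → Set (Set (κ × Bool))}
    (hE : ∀ F : Set (Set (κ × Bool)), (∀ e ∈ F, e.Countable) → #F ≤ ℵ₁ → ∃ ξ, E ξ = F)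
    {D : Set (κ → Bool)} {β : (κ → Bool) → κ} (hD : ∀ d ∈ D, GenericBelow E (β d) d)
    (hβ : ∀ γ, ∃ d ∈ D, γ < β d) {s : (κ → Bool) → Set (κ × Bool)}
    (hs : ∀ d, s d ⊆ literals d) (hsc : ∀ d, (s d).Countable) :
    ∃ d ∈ D, ∃ d' ∈ D, d ≠ d' ∧ s d ⊆ literals d' := by
  obtain ⟨d₀, hd₀, -⟩ := hβ (Classical.choice ⟨β fun _ ↦ false⟩)
  have hg : ∀ p : Set (κ × Bool), ∃ g ∈ D,
      (∃ d ∈ D, Consistent (p ∪ s d)) → Consistent (p ∪ s g) := fun p ↦ by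
    by_cases h : ∃ d ∈ D, Consistent (p ∪ s d)
    · obtain ⟨d, hd, hc⟩ := h
      exact ⟨d, hd, fun _ ↦ hc⟩
    · exact ⟨d₀, hd₀, fun h' ↦ (h h').elim⟩
  choose g hgD hg using hg
  obtain ⟨C, hC, hGC⟩ := exists_closed_set_of_countable_operation hCH
    (fun p ↦ (Prod.fst '' s (g p)) ×ˢ (Set.univ : Set Bool))
    (fun p ↦ ((hsc _).image _).prod countable_univ)
  let P : Set (Set (κ × Bool)) := {p | p ⊆ C ∧ #p ≤ ℵ₀}
  have hP : #P ≤ ℵ₁ := by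
    refine (mk_bounded_subset_le _ ℵ₀).trans ?_
    refine (power_le_power_right (max_le hC aleph0_lt_aleph_one.le)).trans ?_
    rw [← hCH, ← power_mul, aleph0_mul_aleph0]
  have hPC : ∀ p ∈ P, ∀ l ∈ s (g p), ∀ t, (l.1, t) ∈ C := fun p hp l hl t ↦
    hGC p hp.1 (mk_le_aleph0_iff.1 hp.2) ⟨⟨l, hl, rfl⟩, mem_univ t⟩
  obtain ⟨ξ, hξ⟩ := hE ((fun p ↦ s (g p)) '' P) (by rintro _ ⟨p, -, rfl⟩; exact hsc _)
    (mk_image_le.trans hP)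
  obtain ⟨γ, hγ⟩ := hbdd ({ξ} ∪ Prod.fst '' C ∪ (fun p ↦ β (g p)) '' P) <| by
    have h1 := aleph0_lt_aleph_one.le
    refine (mk_union_le _ _).trans (add_le_of_le h1 ((mk_union_le _ _).trans
      (add_le_of_le h1 ?_ (mk_image_le.trans hC))) (mk_image_le.trans hP))
    rw [mk_singleton]
    exact one_lt_aleph0.le.trans h1
  obtain ⟨d, hd, hγd⟩ := hβ γ
  have hdec := (hD d hd).2 ξ ((hγ ξ (.inl (.inl rfl))).trans hγd) <| by
    rw [hξ]
    rintro _ ⟨p, hp, rfl⟩ l hl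
    exact (hγ l.1 (.inl (.inr ⟨_, hPC p hp l hl true, rfl⟩))).trans hγd
  rw [hξ] at hdec
  rcases hdec with ⟨_, ⟨p, hp, rfl⟩, h⟩ | ⟨q, hqd, hq, h⟩
  · refine ⟨g p, hgD p, d, hd, fun heq ↦ ?_, h⟩
    have := (hγ (β (g p)) (.inr ⟨p, hp, rfl⟩)).trans hγd
    rw [heq] at this
    exact this.false
  · exfalso
    have hp : q ∩ C ∈ P := ⟨inter_subset_right, (hq.mono inter_subset_left).le_aleph0⟩
    have hcons : Consistent (q ∩ C ∪ s (g (q ∩ C))) := hg _ ⟨d, hd,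
      (consistent_literals d).mono (union_subset (inter_subset_left.trans hqd) (hs d))⟩
    refine h _ ⟨_, hp, rfl⟩ fun a h₁ h₂ ↦ ?_
    rcases h₁ with h₁ | h₁ <;> rcases h₂ with h₂ | h₂
    · exact consistent_literals d a (hqd h₁) (hqd h₂)
    · exact hcons a (.inl ⟨h₁, hPC _ hp _ h₂ _⟩) (.inr h₂)
    · exact hcons a (.inr h₁) (.inl ⟨h₂, hPC _ hp _ h₁ _⟩)
    · exact consistent_literals _ a (hs _ h₁) (hs _ h₂)

theorem exists_enumeration (hCH1 : (2 : Cardinal.{0}) ^ ℵ₁ = ℵ_ 2) (hκ : #κ = ℵ_ 2) :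
    ∃ E : κ → Set (Set (κ × Bool)), (∀ ξ, ∀ e ∈ E ξ, e.Countable) ∧
      ∀ F : Set (Set (κ × Bool)), (∀ e ∈ F, e.Countable) → #F ≤ ℵ₁ → ∃ ξ, E ξ = F := by
  have h01 := aleph0_lt_aleph_one.le
  have h02 : ℵ₀ ≤ ℵ_ 2 := aleph0_le_aleph 2
  have hL : #(κ × Bool) ≤ ℵ_ 2 := by
    rw [mk_prod, lift_id, lift_id, hκ]
    exact mul_le_of_le h02 le_rfl ((mk_le_aleph0 (α := Bool)).trans h02)
  have hpow : (ℵ_ 2 : Cardinal.{0}) ^ ℵ₁ = ℵ_ 2 := by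
    rw [← hCH1, ← power_mul, mul_eq_self h01]
  have hcount : #{e : Set (κ × Bool) | e.Countable} ≤ ℵ_ 2 := by
    have := mk_bounded_set_le (κ × Bool) ℵ₀
    simp only [mk_le_aleph0_iff] at this
    refine this.trans ((power_le_power_right (max_le hL h02)).trans ?_)
    exact (power_le_power_left (aleph_pos 2).ne' h01).trans hpow.le
  have hfam : #{F : Set (Set (κ × Bool)) // F ⊆ {e | e.Countable} ∧ #F ≤ ℵ₁} ≤ #κ := by
    rw [hκ]
    exact (mk_bounded_subset_le _ ℵ₁).trans
      ((power_le_power_right (max_le hcount h02)).trans hpow.le)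
  obtain ⟨f⟩ := hfam
  have : Nonempty {F : Set (Set (κ × Bool)) // F ⊆ {e | e.Countable} ∧ #F ≤ ℵ₁} :=
    ⟨∅, empty_subset _, by simp⟩
  refine ⟨fun ξ ↦ (Function.invFun f ξ).1, fun ξ ↦ (Function.invFun f ξ).2.1, fun F hF hF' ↦ ?_⟩
  exact ⟨f ⟨F, fun e he ↦ hF e he, hF'⟩,
    congrArg Subtype.val (Function.leftInverse_invFun f.injective _)⟩

/-- The topology on a set of `Bool`-valued functions generated by countable conditions. -/
@[reducible] def countableBoxTopology (Y : Set (κ → Bool)) : TopologicalSpace Y where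
  IsOpen U := ∀ y ∈ U, ∃ b : Set κ, b.Countable ∧
    ∀ y' : Y, (∀ a ∈ b, y'.1 a = y.1 a) → y' ∈ U
  isOpen_univ _ _ := ⟨∅, countable_empty, fun _ _ ↦ mem_univ _⟩
  isOpen_inter U V hU hV y hy := by
    obtain ⟨b, hb, h⟩ := hU y hy.1
    obtain ⟨c, hc, h'⟩ := hV y hy.2
    exact ⟨b ∪ c, hb.union hc, fun y' hy' ↦
      ⟨h y' fun a ha ↦ hy' a (.inl ha), h' y' fun a ha ↦ hy' a (.inr ha)⟩⟩
  isOpen_sUnion S hS y hy := by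
    obtain ⟨U, hU, hyU⟩ := hy
    obtain ⟨b, hb, h⟩ := hS U hU y hyU
    exact ⟨b, hb, fun y' hy' ↦ ⟨U, hU, h y' hy'⟩⟩

variable {Y : Set (κ → Bool)}

theorem isOpen_countableBox {b : Set κ} (hb : b.Countable) (y : Y) :
    IsOpen[countableBoxTopology Y] {y' : Y | ∀ a ∈ b, y'.1 a = y.1 a} :=
  fun _ hy₁ ↦ ⟨b, hb, fun _ hy' a ha ↦ (hy' a ha).trans (hy₁ a ha)⟩

theorem isClosed_countableBox (b : Set κ) (y : Y) :
    IsClosed[countableBoxTopology Y] {y' : Y | ∀ a ∈ b, y'.1 a = y.1 a} := by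
  let _ := countableBoxTopology Y
  refine ⟨fun y₁ hy₁ ↦ ?_⟩
  simp only [mem_compl_iff, mem_ofPred_eq, not_forall] at hy₁
  obtain ⟨a, ha, hne⟩ := hy₁
  exact ⟨{a}, countable_singleton a, fun y' hy' h ↦ hne ((hy' a rfl).symm.trans (h a ha))⟩

theorem t3Space_countableBox : @T3Space Y (countableBoxTopology Y) := by
  let _ := countableBoxTopology Y
  have : T0Space Y := by
    refine ⟨fun x y hxy ↦ Subtype.ext (funext fun a ↦ ?_)⟩
    have := (hxy.mem_open_iff (isOpen_countableBox (countable_singleton a) y)).2 fun _ _ ↦ rfl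
    exact this a rfl
  have : RegularSpace Y := by
    refine .of_exists_mem_nhds_isClosed_subset fun y U hU ↦ ?_
    obtain ⟨V, hVU, hV, hy⟩ := mem_nhds_iff.1 hU
    obtain ⟨b, hb, h⟩ := hV y hy
    exact ⟨_, (isOpen_countableBox hb y).mem_nhds fun _ _ ↦ rfl, isClosed_countableBox b y,
      fun y' hy' ↦ hVU (h y' hy')⟩
  exact {}

theorem isOpen_of_isGδ_countableBox {s : Set Y} (hs : @IsGδ Y (countableBoxTopology Y) s) :
    IsOpen[countableBoxTopology Y] s := by
  let _ := countableBoxTopology Y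
  obtain ⟨S, hS, hSc, rfl⟩ := hs
  intro y hy
  choose! b hb h using fun U (hU : U ∈ S) ↦ hS U hU y (hy U hU)
  exact ⟨⋃ U ∈ S, b U, hSc.biUnion hb, fun y' hy' U hU ↦
    h U hU y' fun a ha ↦ hy' a (mem_biUnion hU ha)⟩

end Literals

/-- Assuming `2^ℵ₀ = ℵ₁` and `2^ℵ₁ = ℵ₂`, there is a T3 space `Y = X ∪ {∞}` which is a
P-space, in which the point `∞` is not isolated, yet `∞` is not in the closure of any
discrete subset of `X = Y \ {∞}`. -/
theorem exists_Pspace_point_not_in_closure_of_discrete_sets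
    (hCH : (2 : Cardinal) ^ Cardinal.aleph 0 = Cardinal.aleph 1)
    (hCH1 : (2 : Cardinal) ^ Cardinal.aleph 1 = Cardinal.aleph 2) :
    ∃ (Y : Type) (_ : TopologicalSpace Y) (infty : Y),
      T3Space Y ∧
      (∀ s : Set Y, IsGδ s → IsOpen s) ∧
      ¬ IsOpen ({infty} : Set Y) ∧
      (∀ D : Set Y, D ⊆ {infty}ᶜ → DiscreteTopology D → infty ∉ closure D) := by
  have hCH' : (2 : Cardinal.{0}) ^ ℵ₀ = ℵ₁ := by
    apply Cardinal.lift_injective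
    simpa using hCH
  have hCH1' : (2 : Cardinal.{0}) ^ ℵ₁ = ℵ_ 2 := by
    apply Cardinal.lift_injective
    simpa using hCH1
  obtain ⟨κ, _, _, hκ, hIio, hbdd⟩ := exists_wellOrder_of_isRegular aleph_two_isRegular
  simp only [lt_aleph_two_iff] at hIio hbdd
  obtain ⟨E, hEc, hE⟩ := exists_enumeration hCH1' hκ
  have hcountable : ∀ {b : Set κ}, b.Countable → #b ≤ ℵ₁ := fun hb ↦
    hb.le_aleph0.trans aleph0_lt_aleph_one.le
  let top : κ → Bool := fun _ ↦ true
  let Y : Set (κ → Bool) := insert top {x | ∃ β, GenericBelow E β x}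
  let _ : TopologicalSpace Y := countableBoxTopology Y
  let infty : Y := ⟨top, mem_insert _ _⟩
  refine ⟨Y, inferInstance, infty, t3Space_countableBox, fun s ↦ isOpen_of_isGδ_countableBox,
    fun h ↦ ?_, fun D hD hdisc hcl ↦ ?_⟩
  · obtain ⟨b, hb, hbU⟩ := h infty rfl
    obtain ⟨β, hβ⟩ := hbdd b (hcountable hb)
    obtain ⟨x, hx, hxb⟩ := exists_genericBelow hEc (hIio β) hb hβ
    have hxtop : x = top := congrArg Subtype.val (hbU ⟨x, .inr ⟨β, hx⟩⟩ hxb)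
    have := hx.1 β le_rfl
    simp [hxtop, top] at this
  · have hgen : ∀ x ∈ Subtype.val '' D, ∃ β, GenericBelow E β x := by
      rintro _ ⟨y, hy, rfl⟩
      exact y.2.resolve_left fun h ↦ hD hy (Subtype.ext h)
    have : Nonempty κ := by
      rw [← mk_ne_zero_iff, hκ]
      exact (aleph_pos 2).ne'
    choose! β hβ using hgen
    have hsep : ∀ d : κ → Bool, ∃ b : Set κ, b.Countable ∧
        ∀ y ∈ D, y.1 = d → ∀ y' ∈ D, (∀ a ∈ b, y'.1 a = y.1 a) → y' = y := fun d ↦ by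
      by_cases hd : ∃ y ∈ D, y.1 = d
      · obtain ⟨y, hy, rfl⟩ := hd
        obtain ⟨U, hU, hUy⟩ := isOpen_induced_iff.1 (isOpen_discrete {(⟨y, hy⟩ : D)})
        obtain ⟨b, hb, hbU⟩ := hU y (hUy.ge rfl)
        refine ⟨b, hb, fun z hz hzy y' hy' h ↦ ?_⟩
        obtain rfl := Subtype.ext hzy
        exact congrArg Subtype.val (hUy.le (show (⟨y', hy'⟩ : D) ∈ _ from hbU y' h))
      · exact ⟨∅, countable_empty, fun y hy h ↦ (hd ⟨y, hy, h⟩).elim⟩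
    choose b hb hbsep using hsep
    have hunb : ∀ γ, ∃ d ∈ Subtype.val '' D, γ < β d := fun γ ↦ by
      obtain ⟨y, hyγ, hyD⟩ := mem_closure_iff.1 hcl _
        (isOpen_countableBox (countable_singleton γ) infty) fun _ _ ↦ rfl
      refine ⟨y, mem_image_of_mem _ hyD, lt_of_not_ge fun h ↦ ?_⟩
      have h₁ := (hβ y (mem_image_of_mem _ hyD)).1 γ h
      have h₂ : y.1 γ = true := hyγ γ rfl
      simp [h₁] at h₂
    obtain ⟨_, ⟨y, hy, rfl⟩, _, ⟨y', hy', rfl⟩, hne, hsub⟩ :=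
      exists_ne_subset_literals hCH' hbdd hE hβ hunb (s := fun d ↦ (fun a ↦ (a, d a)) '' b d)
        (by rintro d _ ⟨a, -, rfl⟩; rfl) (fun d ↦ (hb d).image _)
    exact hne (congrArg Subtype.val
      (hbsep y y hy rfl y' hy' fun a ha ↦ hsub (mem_image_of_mem _ ha))).symm
end

section
/- Let κ and λ be infinite cardinals with κ^λ = κ, and let 𝒜 be a family of sets, each of cardinality λ, with |𝒜| = κ⁺. Then there exist a subfamily 𝒟 ⊆ 𝒜 with |𝒟| = κ⁺ and a set R (the root) such that A ∩ B = R for every pair of distinct A, B ∈ 𝒟. -/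
open Cardinal Set in
/-- If `κ ^ lam ≤ κ`, some set of size at most `κ` contains `range (h R)` for each of its subsets
`R` of size at most `lam`. -/
theorem exists_mk_le_forall_range_subset {α : Type u} {κ lam : Cardinal.{u}}
    (hκ : ℵ₀ ≤ κ) (hpow : κ ^ lam ≤ κ) (h : Set α → κ.out → α) :
    ∃ M : Set α, #M ≤ κ ∧ ∀ R ⊆ M, #R ≤ lam → range (h R) ⊆ M := by
  let W := WType fun p : κ.out × Set lam.out ↦ p.2
  let g : W → α := WType.elim α fun x ↦ h (range x.2) x.1.1
  have hone : 1 ≤ κ := one_le_aleph0.trans hκ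
  have hshape : #(κ.out × Set lam.out) ≤ κ := by
    rw [mk_prod, lift_id, lift_id, mk_set, mk_out, mk_out]
    exact mul_le_of_le hκ le_rfl
      ((power_le_power_right (ofNat_lt_aleph0.le.trans hκ)).trans hpow)
  have hW : #W ≤ κ := by
    refine WType.cardinalMk_le_of_le ?_
    calc Cardinal.sum (fun p : κ.out × Set lam.out ↦ κ ^ #p.2)
        ≤ Cardinal.sum (fun _ : κ.out × Set lam.out ↦ κ) := by
          refine sum_le_sum _ _ fun p ↦ le_trans ?_ hpow
          refine power_le_power_left (zero_lt_one.trans_le hone).ne' ?_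
          simpa using mk_set_le p.2
      _ ≤ κ := by
          rw [sum_const, lift_id, lift_id]
          exact mul_le_of_le hκ hshape le_rfl
  refine ⟨range g, mk_range_le.trans hW, ?_⟩
  rintro R hR hRcard _ ⟨i, rfl⟩
  rw [← mk_out lam] at hRcard
  obtain ⟨e⟩ := hRcard
  let e' := Equiv.ofInjective e e.injective
  choose w hw using fun x : R ↦ hR x.2
  refine ⟨WType.mk (i, range e) fun s ↦ w (e'.symm s), ?_⟩
  have hrange : range (fun s : range e ↦ g (w (e'.symm s))) = R := by
    simp only [hw]
    exact (e'.symm.surjective.range_comp (fun x : R ↦ (x : α))).trans Subtype.range_coe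
  exact congrArg (h · i) hrange

open Cardinal Set in
/-- A kernel of a large family: a set `R` which can be obtained as the trace of a member of the
family on arbitrary small sets. -/
theorem exists_forall_exists_ssubset_inter_subset {α : Type u} {κ lam : Cardinal.{u}}
    (hκ : ℵ₀ ≤ κ) (hpow : κ ^ lam ≤ κ) {𝒜 : Set (Set α)}
    (hcardA : ∀ A ∈ 𝒜, #A ≤ lam) (hA : κ < #𝒜) :
    ∃ R : Set α, ∀ X : Set α, #X ≤ κ → ∃ A ∈ 𝒜, R ⊂ A ∧ A ∩ X ⊆ R := by
  by_contra! hcon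
  choose X hXcard hX using hcon
  have hsubset : ∀ M : Set α, #M ≤ κ → ∃ A ∈ 𝒜, ¬ A ⊆ M := by
    intro M hM
    by_contra! hsub
    refine hA.not_ge ?_
    calc #𝒜 ≤ #{A : Set α // A ⊆ M ∧ #A ≤ lam} :=
          mk_le_mk_of_subset fun A hA ↦ ⟨hsub A hA, hcardA A hA⟩
      _ ≤ max #M ℵ₀ ^ lam := mk_bounded_subset_le M lam
      _ ≤ κ ^ lam := power_le_power_right (max_le hM hκ)
      _ ≤ κ := hpow
  have : Nonempty α := by
    obtain ⟨A, -, hA⟩ := hsubset ∅ (by simp)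
    obtain ⟨a, -, -⟩ := not_subset.1 hA
    exact ⟨a⟩
  have hcover : ∀ R, ∃ f : κ.out → α, X R ⊆ range f := by
    intro R
    have hR := hXcard R
    rw [← mk_out κ] at hR
    obtain ⟨e⟩ := hR
    refine ⟨Function.extend e Subtype.val fun _ ↦ Classical.arbitrary α, fun x hx ↦
      ⟨e ⟨x, hx⟩, e.injective.extend_apply _ _ _⟩⟩
  choose h hh using hcover
  obtain ⟨M, hM, hclosed⟩ := exists_mk_le_forall_range_subset hκ hpow h
  obtain ⟨A, hA𝒜, hAM⟩ := hsubset M hM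
  refine hX (A ∩ M) A hA𝒜 ⟨inter_subset_left, fun hsub ↦ hAM (hsub.trans inter_subset_right)⟩ ?_
  exact inter_subset_inter_right A <| (hh _).trans <| hclosed _ inter_subset_right <|
    (mk_le_mk_of_subset inter_subset_left).trans (hcardA A hA𝒜)

open Cardinal Set in
/-- A maximal Δ-system whose root is a kernel in the sense of
`exists_forall_exists_ssubset_inter_subset` is large. -/
theorem exists_pairwise_inter_eq {α : Type u} {κ : Cardinal.{u}}
    (hκ : ℵ₀ ≤ κ) {𝒜 : Set (Set α)} (hcardA : ∀ A ∈ 𝒜, #A ≤ κ) {R : Set α}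
    (hR : ∀ X : Set α, #X ≤ κ → ∃ A ∈ 𝒜, R ⊂ A ∧ A ∩ X ⊆ R) :
    ∃ 𝒟 ⊆ 𝒜, κ < #𝒟 ∧ 𝒟.Pairwise fun A B ↦ A ∩ B = R := by
  obtain ⟨𝒟, ⟨h𝒟, hpair⟩, hmax⟩ := zorn_subset
    {𝒟 : Set (Set α) | 𝒟 ⊆ {A ∈ 𝒜 | R ⊂ A} ∧ 𝒟.Pairwise fun A B ↦ A ∩ B = R} fun c hc hchain ↦
      ⟨⋃₀ c, ⟨sUnion_subset fun s hs ↦ (hc hs).1,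
        (pairwise_sUnion hchain.directedOn).2 fun s hs ↦ (hc hs).2⟩,
        fun _ ↦ subset_sUnion_of_mem⟩
  refine ⟨𝒟, fun A hA ↦ (h𝒟 hA).1, ?_, hpair⟩
  by_contra! hle
  have hcard : #(⋃₀ 𝒟) ≤ κ := (mk_sUnion_le 𝒟).trans <|
    mul_le_of_le hκ hle <| ciSup_le' fun A ↦ hcardA A (h𝒟 A.2).1
  obtain ⟨A, hA𝒜, hRA, hAR⟩ := hR _ hcard
  have hinter : ∀ B ∈ 𝒟, A ∩ B = R := fun B hB ↦
    ((inter_subset_inter_right A (subset_sUnion_of_mem hB)).trans hAR).antisymm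
      (subset_inter hRA.subset (h𝒟 hB).2.subset)
  have hmem : A ∈ 𝒟 := hmax
    ⟨insert_subset ⟨hA𝒜, hRA⟩ h𝒟, hpair.insert fun B hB _ ↦
      ⟨hinter B hB, (inter_comm B A).trans (hinter B hB)⟩⟩
    (subset_insert A 𝒟) (mem_insert A 𝒟)
  exact hRA.ne ((hinter A hmem).symm.trans (inter_self A))

/-- Higher cardinal Δ-system lemma (Jech, Theorem 9.19): if `κ` and `λ` are infinite
cardinals with `κ ^ λ = κ` and `𝒜` is a family of `κ⁺`-many sets each of cardinality `λ`,
then there is a subfamily `𝒟 ⊆ 𝒜` of cardinality `κ⁺` forming a Δ-system with some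
root `R`. -/
theorem delta_system_lemma {α : Type u} (κ lam : Cardinal.{u})
    (hκ : Cardinal.aleph0 ≤ κ) (hlam : Cardinal.aleph0 ≤ lam)
    (hpow : κ ^ lam = κ)
    (𝒜 : Set (Set α))
    (hcardA : ∀ A ∈ 𝒜, Cardinal.mk A = lam)
    (hA : Cardinal.mk 𝒜 = Order.succ κ) :
    ∃ 𝒟 ⊆ 𝒜, Cardinal.mk 𝒟 = Order.succ κ ∧
      ∃ R : Set α, ∀ A ∈ 𝒟, ∀ B ∈ 𝒟, A ≠ B → A ∩ B = R := by

  have hlt : lam < κ := (Cardinal.cantor lam).trans_le <|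
    (Cardinal.power_le_power_right (Cardinal.ofNat_lt_aleph0.le.trans hκ)).trans hpow.le
  obtain ⟨R, hR⟩ := exists_forall_exists_ssubset_inter_subset hκ hpow.le
    (fun A h ↦ (hcardA A h).le) (hA ▸ Order.lt_succ κ)
  obtain ⟨𝒟, h𝒟, hcard, hpair⟩ :=
    exists_pairwise_inter_eq hκ (fun A h ↦ (hcardA A h).le.trans hlt.le) hR
  exact ⟨𝒟, h𝒟, (hA ▸ Cardinal.mk_le_mk_of_subset h𝒟).antisymm (Order.succ_le_of_lt hcard), R,
    fun A hA B hB ↦ hpair hA hB⟩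
end

section
/- Assume 2^ℵ₀ = ℵ₁ and 2^ℵ₁ = ℵ₂. Then there exists a topological space X such that: X is regular Hausdorff (T3); X is a P-space (every Gδ subset is open); X has cardinality ℵ₂; X is hereditarily ℵ₁-Lindelöf, i.e., for every subset S ⊆ X, every cover of S by open subsets of X has a subcover of cardinality at most ℵ₁; and every dense subset of X has cardinality ℵ₂ (so the density of X equals ℵ₂). -/
open Cardinal Set

/-- A union of at most `ℵ₁` sets of size at most `ℵ₁` has size at most `ℵ₁`. -/
theorem mk_iUnion_le_aleph_one {ι Y : Type} (f : ι → Set Y) (hι : #ι ≤ ℵ₁)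
    (hf : ∀ i, #(f i) ≤ ℵ₁) : #(⋃ i, f i) ≤ ℵ₁ := by
  refine mk_iUnion_le_sum_mk.trans ((sum_le_sum _ (fun _ => ℵ₁) hf).trans ?_)
  rw [sum_const']
  exact (mul_le_mul_left hι _).trans (mul_eq_self (aleph0_le_aleph 1)).le

theorem mk_biUnion_le_aleph_one {ι Y : Type} (s : Set ι) (f : ι → Set Y) (hs : #s ≤ ℵ₁)
    (hf : ∀ i ∈ s, #(f i) ≤ ℵ₁) : #(⋃ i ∈ s, f i : Set Y) ≤ ℵ₁ := by
  rw [biUnion_eq_iUnion]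
  exact mk_iUnion_le_aleph_one _ hs fun i => hf i i.2

theorem mk_le_aleph_one_of_countable {Y : Type} {s : Set Y} (hs : s.Countable) : #s ≤ ℵ₁ :=
  (le_aleph0_iff_set_countable.2 hs).trans (aleph0_le_aleph 1)

theorem mk_union_le_aleph_one {Y : Type} {s t : Set Y} (hs : #s ≤ ℵ₁) (ht : #t ≤ ℵ₁) :
    #(s ∪ t : Set Y) ≤ ℵ₁ :=
  (mk_union_le s t).trans (add_le_of_le (aleph0_le_aleph 1) hs ht)

theorem aleph_one_power_aleph0 (hCH : (2 : Cardinal.{0}) ^ ℵ₀ = ℵ₁) :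
    (ℵ₁ : Cardinal.{0}) ^ (ℵ₀ : Cardinal.{0}) = ℵ₁ := by
  rw [← hCH, ← power_mul, aleph0_mul_aleph0]

theorem exists_range_eq_of_mk_le {I Y : Type} {s : Set Y} (hs : #s ≤ #I) (hne : s.Nonempty) :
    ∃ f : I → Y, range f = s := by
  obtain ⟨e⟩ := hs
  have := hne.to_subtype
  refine ⟨fun i => (Function.invFun e i : s), ?_⟩
  rw [range_comp' Subtype.val, (Function.invFun_surjective e.injective).range_eq, image_univ,
    Subtype.range_coe]

/-- Under CH, every set operation sending countable sets to sets of size at most `ℵ₁` has a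
set of size at most `ℵ₁` that is closed under it. -/
theorem exists_closed_mk_le_aleph_one (hCH : (2 : Cardinal.{0}) ^ ℵ₀ = ℵ₁) {Y : Type}
    (G : Set Y → Set Y) (hG : ∀ C, C.Countable → #(G C) ≤ ℵ₁) :
    ∃ M : Set Y, #M ≤ ℵ₁ ∧ ∀ C ⊆ M, C.Countable → G C ⊆ M := by
  rcases isEmpty_or_nonempty Y with hY | ⟨⟨y₀⟩⟩
  · exact ⟨∅, by simp, fun C _ _ y => isEmptyElim y⟩
  let I : Type := (ℵ₁ : Cardinal.{0}).ord.ToType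
  have hI : #I = ℵ₁ := mk_ord_toType _
  have hsurj : ∀ C : Set Y, ∃ b : I → Y, C.Countable → G C ⊆ range b := by
    intro C
    by_cases hC : C.Countable
    · have hle : #(insert y₀ (G C) : Set Y) ≤ #I := by
        rw [hI, insert_eq]
        exact mk_union_le_aleph_one (mk_le_aleph_one_of_countable (countable_singleton _))
          (hG C hC)
      obtain ⟨f, hf⟩ := exists_range_eq_of_mk_le hle (insert_nonempty _ _)
      exact ⟨f, fun _ => hf ▸ subset_insert _ _⟩
    · exact ⟨fun _ => y₀, fun h => absurd h hC⟩
  choose b hb using hsurj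
  let arity : I ⊕ I → Type := Sum.elim (fun _ => ℕ) (fun _ => Empty)
  let ev : WType arity → Y := WType.elim Y fun p => match p with
    | ⟨Sum.inl i, f⟩ => b (range (f : ℕ → Y)) i
    | ⟨Sum.inr i, _⟩ => b ∅ i
  refine ⟨range ev, ?_, ?_⟩
  · refine mk_range_le.trans (WType.cardinalMk_le_of_le ?_)
    refine (sum_le_sum _ (fun _ => ℵ₁) ?_).trans ?_
    · rintro (i | i)
      · change ℵ₁ ^ #ℕ ≤ ℵ₁
        rw [mk_nat, aleph_one_power_aleph0 hCH]
      · change ℵ₁ ^ #Empty ≤ ℵ₁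
        simp only [mk_eq_zero, power_zero]
        exact one_le_aleph0.trans (aleph0_le_aleph 1)
    · rw [sum_const', mk_sum, lift_id, hI, add_eq_self (aleph0_le_aleph 1),
        mul_eq_self (aleph0_le_aleph 1)]
  · intro C hCM hC y hy
    obtain ⟨i, rfl⟩ := hb C hC hy
    rcases C.eq_empty_or_nonempty with rfl | hne
    · exact ⟨WType.mk (Sum.inr i) Empty.elim, rfl⟩
    · obtain ⟨g, rfl⟩ := hC.exists_eq_range hne
      choose f hf using fun n => hCM (mem_range_self n)
      refine ⟨WType.mk (Sum.inl i) f, ?_⟩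
      change b (range fun n => ev (f n)) i = b (range g) i
      simp only [hf]

/-- `Agrees f s` says that `f` extends the partial function with graph `s`. -/
def Agrees {K : Type} (f : K → Bool) (s : Set (K × Bool)) : Prop := ∀ p ∈ s, f p.1 = p.2

/-- A family of partial functions is *spread out* if every countable set is missed by
the domain of some member. -/
def SpreadOut {K ι : Type} (σ : ι → Set (K × Bool)) : Prop :=
  ∀ C : Set K, C.Countable → ∃ i, (∃ f, Agrees f (σ i)) ∧ ∀ p ∈ σ i, p.1 ∉ C

/-- Given spread out families indexed by a well-order with countable initial segments,
some total function extends a member of each of them. -/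
theorem exists_agrees_of_spreadOut {J K ι : Type} [LinearOrder J] [WellFoundedLT J]
    (hJ : ∀ j : J, (Iio j).Countable) (σ : J → ι → Set (K × Bool))
    (hc : ∀ j i, (σ j i).Countable) (hσ : ∀ j, SpreadOut (σ j)) :
    ∃ z : K → Bool, ∀ j, ∃ i, Agrees z (σ j i) := by
  rcases isEmpty_or_nonempty J with hJe | ⟨⟨j₀⟩⟩
  · exact ⟨fun _ => true, fun j => isEmptyElim j⟩
  have : Nonempty ι := ⟨(hσ j₀ ∅ countable_empty).choose⟩
  have hσ' := fun j C => (em (Set.Countable C)).elim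
    (fun h => (hσ j C h).imp fun _ hi _ => hi)
    (fun h => ⟨Classical.arbitrary ι, fun h' => absurd h' h⟩)
  choose pick hpick using hσ'
  let F : ∀ j : J, (∀ k, k < j → ι) → ι := fun j ih =>
    pick j (⋃ k : Iio j, Prod.fst '' σ k (ih k k.2))
  let g : J → ι := wellFounded_lt.fix F
  have hg : ∀ j, g j = pick j (⋃ k : Iio j, Prod.fst '' σ k (g k)) :=
    fun j => wellFounded_lt.fix_eq F j
  have hC : ∀ j : J, (⋃ k : Iio j, Prod.fst '' σ k (g k)).Countable := fun j => by
    have : Countable (Iio j) := hJ j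
    exact countable_iUnion fun k => (hc _ _).image _
  have hagree : ∀ j, ∃ f, Agrees f (σ j (g j)) := fun j => by
    rw [hg]; exact (hpick j _ (hC j)).1
  have hdisj : ∀ j k, k < j → ∀ p ∈ σ j (g j), ∀ q ∈ σ k (g k), p.1 ≠ q.1 := by
    intro j k hkj p hp q hq hpq
    rw [hg] at hp
    exact (hpick j _ (hC j)).2 p hp (mem_iUnion.2 ⟨⟨k, hkj⟩, q, hq, hpq.symm⟩)
  classical
  refine ⟨fun x => decide (∃ j, (x, true) ∈ σ j (g j)), fun j => ⟨g j, fun p hp => ?_⟩⟩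
  obtain ⟨x, v⟩ := p
  obtain ⟨f, hf⟩ := hagree j
  cases v with
  | true => exact decide_eq_true ⟨j, hp⟩
  | false =>
    refine decide_eq_false ?_
    rintro ⟨k, hk⟩
    rcases lt_trichotomy k j with h | rfl | h
    · exact hdisj j k h _ hp _ hk rfl
    · have h₁ := hf _ hp
      have h₂ := hf _ hk
      exact Bool.noConfusion (h₁.symm.trans h₂)
    · exact hdisj k j h _ hk _ hp rfl

/-- There is a sequence of functions, upper triangular with ones on the diagonal, such that every
spread out `ℵ₁`-indexed family is met by all but `ℵ₁` of its terms. -/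
theorem exists_triangular_meeting_spreadOut
    (hCH1 : (2 : Cardinal.{0}) ^ ℵ₁ = ℵ_ 2) {K I : Type} [LinearOrder K]
    (hI : #I = ℵ₁) (hK : #K = ℵ_ 2) (hIic : ∀ a : K, #(Iic a) ≤ ℵ₁)
    (hbdd : ∀ s : Set K, #s ≤ ℵ₁ → ∃ a, ∀ b ∈ s, b < a) :
    ∃ x : K → K → Bool, (∀ a, x a a = true) ∧ (∀ a b, a < b → x a b = false) ∧
      ∀ σ : I → Set (K × Bool), (∀ i, (σ i).Countable) → SpreadOut σ →
        ∃ N : Set K, #N ≤ ℵ₁ ∧ ∀ b ∉ N, ∃ i, Agrees (x b) (σ i) := by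
  let T : Type := {s : Set (K × Bool) // s.Countable}
  have h0 : ℵ₀ ≤ ℵ_ (2 : Ordinal.{0}) := aleph0_le_aleph 2
  have h2 : (ℵ_ 2 : Cardinal.{0}) ^ (ℵ₁ : Cardinal.{0}) = ℵ_ 2 := by
    rw [← hCH1, ← power_mul, mul_eq_self (aleph0_le_aleph 1)]
  have hKB : #(K × Bool) ≤ ℵ_ 2 := by
    rw [mk_prod, lift_id, lift_id, hK, mk_bool]
    exact (mul_le_mul_right (ofNat_le_aleph0.trans h0) _).trans (mul_eq_self h0).le
  have hT : #T ≤ ℵ_ 2 := by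
    have h := mk_bounded_set_le (K × Bool) ℵ₀
    have e : #T = #{t : Set (K × Bool) // #t ≤ ℵ₀} :=
      mk_congr (Equiv.subtypeEquivRight fun s => le_aleph0_iff_set_countable.symm)
    rw [e]
    refine h.trans ((power_le_power_right (max_le hKB h0)).trans ?_)
    exact (power_le_power_left (aleph_pos 2).ne' (aleph0_le_aleph 1)).trans h2.le
  have hΦ : #(I → T) ≤ #K := by
    rw [mk_arrow, lift_id, lift_id, hI, hK]
    exact (power_le_power_right hT).trans h2.le
  obtain ⟨code⟩ := hΦ
  let W : Type := (ℵ₁ : Cardinal.{0}).ord.ToType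
  have hW : ∀ j : W, (Iio j).Countable := fun j => by
    rw [← le_aleph0_iff_set_countable, ← Order.lt_succ_iff, succ_aleph0]
    exact (mk_Iio_lt j (by simp [W])).trans_eq (mk_ord_toType _)
  have hz : ∀ b : K, ∃ z : K → Bool, ∀ τ : I → T, code τ ≤ b → SpreadOut (fun i => (τ i).1) →
      ∃ i, Agrees z (τ i).1 := by
    intro b
    let S : Set (I → T) := {τ | code τ ≤ b ∧ SpreadOut (fun i => (τ i).1)}
    have hS : #S ≤ #W := by
      rw [mk_ord_toType]
      refine le_trans ?_ (hIic b)
      exact mk_le_of_injective (f := fun τ : S => (⟨code τ, τ.2.1⟩ : Iic b))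
        fun τ τ' h => Subtype.ext (code.injective (congrArg Subtype.val h))
    rcases isEmpty_or_nonempty S with hSe | hSn
    · exact ⟨fun _ => true, fun τ h h' => (hSe.false ⟨τ, h, h'⟩).elim⟩
    obtain ⟨e⟩ := hS
    obtain ⟨z, hz⟩ := exists_agrees_of_spreadOut hW
      (fun j i => ((Function.invFun e j).1 i).1) (fun j i => ((Function.invFun e j).1 i).2)
      (fun j => (Function.invFun e j).2.2)
    refine ⟨z, fun τ h h' => ?_⟩
    have := hz (e ⟨τ, h, h'⟩)
    rwa [Function.leftInverse_invFun e.injective] at this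
  choose z hz using hz
  refine ⟨fun b c => if c < b then z b c else decide (c = b), by simp, ?_, ?_⟩
  · intro a b hab
    simp [hab.not_gt, hab.ne']
  · intro σ hσc hσ
    let τ : I → T := fun i => ⟨σ i, hσc i⟩
    obtain ⟨a, ha⟩ := hbdd (⋃ i, Prod.fst '' σ i)
      (mk_iUnion_le_aleph_one _ hI.le fun i => mk_le_aleph_one_of_countable ((hσc i).image _))
    refine ⟨Iic (max a (code τ)), hIic _, fun b hb => ?_⟩
    rw [mem_Iic, not_le, max_lt_iff] at hb
    obtain ⟨i, hi⟩ := hz b τ hb.2.le hσ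
    refine ⟨i, fun p hp => ?_⟩
    have : p.1 < b := (ha _ (mem_iUnion.2 ⟨i, p, hp, rfl⟩)).trans hb.1
    simp only [if_pos this]
    exact hi p hp

/-- If every spread out family is met by all but `ℵ₁` terms of `x`, then among points that agree
on a countable set `E`, all those avoiding a suitable set `G` of size `ℵ₁` lie in the basic
neighbourhoods of points of `G`. -/
theorem exists_small_capturing (hCH : (2 : Cardinal.{0}) ^ ℵ₀ = ℵ₁) {K I : Type}
    (hI : #I = ℵ₁) {x : K → K → Bool}
    (hx : ∀ σ : I → Set (K × Bool), (∀ i, (σ i).Countable) → SpreadOut σ →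
        ∃ N : Set K, #N ≤ ℵ₁ ∧ ∀ b ∉ N, ∃ i, Agrees (x b) (σ i))
    {D : K → Set K} (hD : ∀ a, (D a).Countable) (E S : Set K)
    (hE : ∀ a ∈ S, ∀ b ∈ S, ∀ c ∈ E, x a c = x b c) :
    ∃ G : Set K, #G ≤ ℵ₁ ∧ ∀ b ∈ S, Disjoint (D b \ E) G → b ∉ G →
      ∃ a ∈ G ∩ S, ∀ c ∈ D a, x b c = x a c := by
  by_cases hgood : ∀ B : Set K, #B ≤ ℵ₁ → ∃ a ∈ S, Disjoint (D a \ E) B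
  · have hpick : ∀ C : Set K, ∃ a, C.Countable → a ∈ S ∧ Disjoint (D a \ E) C := fun C =>
      (em C.Countable).elim
        (fun h => (hgood C (mk_le_aleph_one_of_countable h)).imp fun _ ha _ => ha)
        (fun h => (hgood ∅ (by simp)).imp fun _ _ h' => absurd h' h)
    choose pick hpick using hpick
    obtain ⟨M, hM, hMc⟩ := exists_closed_mk_le_aleph_one hCH (fun C => D (pick C))
      fun C _ => mk_le_aleph_one_of_countable (hD _)
    let F : Set K := pick '' {C | C ⊆ M ∧ C.Countable}
    have hF : #F ≤ ℵ₁ := by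
      refine mk_image_le.trans ?_
      have e : {C | C ⊆ M ∧ C.Countable} = {C : Set K | C ⊆ M ∧ #C ≤ ℵ₀} := by
        simp only [le_aleph0_iff_set_countable]
      rw [e]
      refine (mk_bounded_subset_le M ℵ₀).trans ?_
      exact (power_le_power_right (max_le hM (aleph0_le_aleph 1))).trans
        (aleph_one_power_aleph0 hCH).le
    have hFS : F ⊆ S := by
      rintro _ ⟨C, hC, rfl⟩
      exact (hpick C hC.2).1
    obtain ⟨φ, hφ⟩ := exists_range_eq_of_mk_le (I := I) (hF.trans hI.ge)
      ⟨pick ∅, mem_image_of_mem _ ⟨empty_subset _, countable_empty⟩⟩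
    obtain ⟨N, hN, hNx⟩ := hx (fun i => (fun c => (c, x (φ i) c)) '' (D (φ i) \ E))
      (fun i => ((hD _).mono sdiff_subset).image _) (by
        intro C hC
        have hCM : C ∩ M ⊆ M ∧ (C ∩ M).Countable := ⟨inter_subset_right, hC.mono inter_subset_left⟩
        obtain ⟨i, hi⟩ : pick (C ∩ M) ∈ range φ := hφ ▸ mem_image_of_mem _ hCM
        refine ⟨i, ⟨x (φ i), ?_⟩, ?_⟩
        · rintro _ ⟨c, -, rfl⟩
          rfl
        · rintro _ ⟨c, hc, rfl⟩ hcC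
          rw [hi] at hc
          exact disjoint_left.1 (hpick _ hCM.2).2 hc ⟨hcC, hMc _ hCM.1 hCM.2 hc.1⟩)
    refine ⟨F ∪ N, mk_union_le_aleph_one hF hN, fun b hb _ hbG => ?_⟩
    obtain ⟨i, hi⟩ := hNx b fun h => hbG (Or.inr h)
    have hiF : φ i ∈ F := hφ ▸ mem_range_self i
    refine ⟨φ i, ⟨Or.inl hiF, hFS hiF⟩, fun c hc => ?_⟩
    by_cases hcE : c ∈ E
    · exact hE b hb _ (hFS hiF) c hcE
    · exact hi _ (mem_image_of_mem _ ⟨hc, hcE⟩)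
  · push Not at hgood
    obtain ⟨B, hB, h⟩ := hgood
    exact ⟨B, hB, fun b hb hd => absurd hd (h b hb)⟩

/-- If every spread out family is met by all but `ℵ₁` terms of `x`, then any assignment of basic
neighbourhoods to the points of a set `S` has a subcover of size `ℵ₁`. -/
theorem exists_small_subcover (hCH : (2 : Cardinal.{0}) ^ ℵ₀ = ℵ₁) {K I : Type}
    (hI : #I = ℵ₁) {x : K → K → Bool}
    (hx : ∀ σ : I → Set (K × Bool), (∀ i, (σ i).Countable) → SpreadOut σ →
        ∃ N : Set K, #N ≤ ℵ₁ ∧ ∀ b ∉ N, ∃ i, Agrees (x b) (σ i))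
    {D : K → Set K} (hD : ∀ a, (D a).Countable) (S : Set K) :
    ∃ A ⊆ S, #A ≤ ℵ₁ ∧ ∀ b ∈ S, ∃ a ∈ A, ∀ c ∈ D a, x b c = x a c := by
  choose G hG hGS using fun (E : Set K) (f : E → Bool) => exists_small_capturing hCH hI hx hD E
    {a ∈ S | ∀ c : E, x a c = f c}
    (fun a ha b hb c hc => (ha.2 ⟨c, hc⟩).trans (hb.2 ⟨c, hc⟩).symm)
  obtain ⟨M, hM, hMc⟩ := exists_closed_mk_le_aleph_one hCH (fun E => ⋃ f : E → Bool, G E f)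
    (fun E hE => mk_iUnion_le_aleph_one _ (by
      rw [mk_arrow, lift_id, lift_id, mk_bool, ← hCH]
      exact power_le_power_left two_ne_zero (le_aleph0_iff_set_countable.2 hE)) (hG E))
  refine ⟨M ∩ S, inter_subset_right, (mk_le_mk_of_subset inter_subset_left).trans hM,
    fun b hb => ?_⟩
  by_cases hbM : b ∈ M
  · exact ⟨b, ⟨hbM, hb⟩, fun _ _ => rfl⟩
  let E := D b ∩ M
  have hGM : G E (fun c => x b c) ⊆ M := (subset_iUnion _ _).trans
    (hMc E inter_subset_right ((hD b).mono inter_subset_left))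
  obtain ⟨a, ⟨haG, haS, -⟩, ha⟩ := hGS E (fun c => x b c) b ⟨hb, fun _ => rfl⟩
    (disjoint_left.2 fun c hc hcG => hc.2 ⟨hc.1, hGM hcG⟩) (fun h => hbM (hGM h))
  exact ⟨a, ⟨hGM haG, haS⟩, ha⟩

/-- The topology on `K` induced by `x : K → (K → Bool)` from the countable-support box topology. -/
abbrev agreementTopology {K : Type} (x : K → K → Bool) : TopologicalSpace K where
  IsOpen U := ∀ a ∈ U, ∃ D : Set K, D.Countable ∧ ∀ b, (∀ c ∈ D, x b c = x a c) → b ∈ U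
  isOpen_univ := fun _ _ => ⟨∅, countable_empty, fun _ _ => mem_univ _⟩
  isOpen_inter := by
    rintro U V hU hV a ⟨haU, haV⟩
    obtain ⟨D, hD, h⟩ := hU a haU
    obtain ⟨E, hE, h'⟩ := hV a haV
    exact ⟨D ∪ E, hD.union hE, fun b hb =>
      ⟨h b fun c hc => hb c (Or.inl hc), h' b fun c hc => hb c (Or.inr hc)⟩⟩
  isOpen_sUnion := by
    rintro 𝒰 h𝒰 a ⟨U, hU, ha⟩
    obtain ⟨D, hD, h⟩ := h𝒰 U hU a ha
    exact ⟨D, hD, fun b hb => ⟨U, hU, h b hb⟩⟩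

section agreementTopology

variable {K : Type} (x : K → K → Bool)

theorem isClopen_agreementTopology {D : Set K} (hD : D.Countable) (f : K → Bool) :
    @IsClopen K (agreementTopology x) {b | ∀ c ∈ D, x b c = f c} := by
  let := agreementTopology x
  exact ⟨⟨fun a ha => ⟨D, hD, fun b hb h => ha fun c hc => (hb c hc).symm.trans (h c hc)⟩⟩,
    fun a ha => ⟨D, hD, fun b hb c hc => (hb c hc).trans (ha c hc)⟩⟩

theorem t3Space_agreementTopology (hx : Function.Injective x) :
    @T3Space K (agreementTopology x) := by
  let := agreementTopology x
  have : RegularSpace K := .of_exists_mem_nhds_isClosed_subset fun a s hs => by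
    obtain ⟨U, hUs, hU, ha⟩ := mem_nhds_iff.1 hs
    obtain ⟨D, hD, h⟩ := hU a ha
    have hclopen := isClopen_agreementTopology x hD (x a)
    exact ⟨_, hclopen.isOpen.mem_nhds fun _ _ => rfl, hclopen.isClosed,
      fun b hb => hUs (h b hb)⟩
  have : T0Space K := ⟨fun a b hab => hx (funext fun c => by
    have h := hab.mem_open_iff
      (isClopen_agreementTopology x (countable_singleton c) (x b)).isOpen
    exact h.2 (fun _ _ => rfl) c rfl)⟩
  infer_instance

theorem isOpen_of_isGδ_agreementTopology {s : Set K} (hs : @IsGδ K (agreementTopology x) s) :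
    @IsOpen K (agreementTopology x) s := by
  obtain ⟨T, hT, hTc, rfl⟩ := hs
  intro a ha
  choose! D hD h using fun t (ht : t ∈ T) => hT t ht a (ha t ht)
  exact ⟨⋃ t ∈ T, D t, hTc.biUnion hD, fun b hb t ht => h t ht b fun c hc =>
    hb c (mem_biUnion ht hc)⟩

end agreementTopology

/-- Assuming `2^ℵ₀ = ℵ₁` and `2^ℵ₁ = ℵ₂`, there is a T3 P-space of cardinality `ℵ₂`
which is hereditarily `ℵ₁`-Lindelöf and in which every dense subset has cardinality
`ℵ₂` (so its density is `ℵ₂`). -/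
theorem exists_Pspace_hL_aleph1_density_aleph2
    (hCH : (2 : Cardinal) ^ Cardinal.aleph 0 = Cardinal.aleph 1)
    (hCH1 : (2 : Cardinal) ^ Cardinal.aleph 1 = Cardinal.aleph 2) :
    ∃ (X : Type) (_ : TopologicalSpace X),
      T3Space X ∧
      (∀ s : Set X, IsGδ s → IsOpen s) ∧
      Cardinal.mk X = Cardinal.aleph 2 ∧
      (∀ (S : Set X) (𝒰 : Set (Set X)), (∀ U ∈ 𝒰, IsOpen U) → S ⊆ ⋃₀ 𝒰 →
        ∃ 𝒱 ⊆ 𝒰, Cardinal.mk 𝒱 ≤ Cardinal.aleph 1 ∧ S ⊆ ⋃₀ 𝒱) ∧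
      (∀ S : Set X, Dense S → Cardinal.mk S = Cardinal.aleph 2) := by
  have hCH' : (2 : Cardinal.{0}) ^ ℵ₀ = ℵ₁ := by
    have h := congrArg lift.{0} hCH
    rw [aleph_zero] at h
    exact lift_injective (by simpa using h)
  have hCH1' : (2 : Cardinal.{0}) ^ ℵ₁ = ℵ_ 2 := lift_injective (by simpa using hCH1)
  have hsucc : (ℵ_ 2 : Cardinal.{0}) = Order.succ ℵ₁ := by
    rw [succ_aleph, one_add_one_eq_two]
  let I : Type := (ℵ₁ : Cardinal.{0}).ord.ToType
  let K : Type := (ℵ_ 2 : Cardinal.{0}).ord.ToType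
  have hI : #I = ℵ₁ := mk_ord_toType _
  have hK : #K = ℵ_ 2 := mk_ord_toType _
  have hIic : ∀ a : K, #(Iic a) ≤ ℵ₁ := fun a => by
    rw [← Order.lt_succ_iff, ← hsucc]
    exact (mk_Iic_lt a (by simp [K]) (hK ▸ aleph0_le_aleph 2)).trans_eq hK
  have hbdd : ∀ s : Set K, #s ≤ ℵ₁ → ∃ a, ∀ b ∈ s, b < a := by
    intro s hs
    by_contra! h
    have huniv : (⋃ b ∈ s, Iic b) = Set.univ := eq_univ_of_forall fun a => by
      obtain ⟨b, hb, hab⟩ := h a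
      exact mem_biUnion hb hab
    have hle := mk_biUnion_le_aleph_one s Iic hs fun b _ => hIic b
    rw [huniv, mk_univ, hK, hsucc] at hle
    exact (Order.lt_succ _).not_ge hle
  obtain ⟨x, hdiag, hupper, hx⟩ := exists_triangular_meeting_spreadOut hCH1' hI hK hIic hbdd
  have hinj : Function.Injective x := by
    have hne : ∀ a b, a < b → x a ≠ x b := fun a b hab h => by
      have := hupper a b hab
      rw [h, hdiag] at this
      exact Bool.noConfusion this
    intro a b h
    rcases lt_trichotomy a b with hab | hab | hab
    exacts [absurd h (hne a b hab), hab, absurd h.symm (hne b a hab)]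
  refine ⟨K, agreementTopology x, t3Space_agreementTopology x hinj,
    fun s => isOpen_of_isGδ_agreementTopology x, hK, ?_, ?_⟩
  · intro S 𝒰 h𝒰 hS
    have hD : ∀ a, ∃ (U : Set K) (D : Set K), D.Countable ∧
        (a ∈ S → U ∈ 𝒰 ∧ ∀ b, (∀ c ∈ D, x b c = x a c) → b ∈ U) := fun a => by
      by_cases ha : a ∈ S
      · obtain ⟨U, hU, haU⟩ := hS ha
        obtain ⟨D, hD, h⟩ := h𝒰 U hU a haU
        exact ⟨U, D, hD, fun _ => ⟨hU, h⟩⟩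
      · exact ⟨∅, ∅, countable_empty, fun h => absurd h ha⟩
    choose U D hD hUD using hD
    obtain ⟨A, hAS, hA, hcover⟩ := exists_small_subcover hCH' hI hx hD S
    refine ⟨U '' A, ?_, mk_image_le.trans hA, fun b hb => ?_⟩
    · rintro _ ⟨a, ha, rfl⟩
      exact (hUD a (hAS ha)).1
    · obtain ⟨a, ha, hab⟩ := hcover b hb
      exact ⟨U a, mem_image_of_mem U ha, (hUD a (hAS ha)).2 b hab⟩
  · intro S hS
    refine le_antisymm ((mk_set_le S).trans hK.le) ?_
    rw [hsucc, Order.succ_le_iff]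
    by_contra! h
    obtain ⟨a, ha⟩ := hbdd S h
    let := agreementTopology x
    obtain ⟨b, hb, hbS⟩ := hS.inter_open_nonempty _
      (isClopen_agreementTopology x (countable_singleton a) (x a)).isOpen ⟨a, fun _ _ => rfl⟩
    have := hb a rfl
    rw [hdiag, hupper b a (ha b hbS)] at this
    exact Bool.noConfusion this
end

section
/- Every compact Hausdorff topological space is weakly discretely generated: if X is compact Hausdorff and A ⊆ X is not closed, then there exists a subset D ⊆ A, discrete in its subspace topology, such that the closure of D in X meets the complement of A. -/
open Set Topology

/-- Along a well-order, one can greedily pick at most one point from each level set `P i`, namely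
a point outside the closure of the points picked so far whenever there is one. -/
theorem exists_greedy_selection {X ι : Type*} [TopologicalSpace X] [LinearOrder ι]
    [WellFoundedLT ι] (P : ι → Set X) :
    ∃ d : ι → Set X, ∀ i, (d i).Subsingleton ∧ d i ⊆ P i \ closure (⋃ j < i, d j) ∧
      ((P i \ closure (⋃ j < i, d j)).Nonempty → (d i).Nonempty) := by
  have pick (S : Set X) : ∃ T ⊆ S, T.Subsingleton ∧ (S.Nonempty → T.Nonempty) := by
    rcases S.eq_empty_or_nonempty with rfl | ⟨x, hx⟩
    · exact ⟨∅, by simp⟩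
    · exact ⟨{x}, by simpa using hx, subsingleton_singleton, fun _ => singleton_nonempty x⟩
  choose p hpS hp1 hpne using pick
  let ind (i : ι) (d : ∀ j < i, Set X) : Set X := p (P i \ closure (⋃ j, ⋃ h : j < i, d j h))
  refine ⟨WellFoundedLT.fix ind, fun i => ?_⟩
  have key : WellFoundedLT.fix ind i =
      p (P i \ closure (⋃ j < i, WellFoundedLT.fix ind j)) := WellFoundedLT.fix_eq ind i
  rw [key]
  exact ⟨hp1 _, hpS _, hpne _⟩

/-- If `A` is covered by a well-ordered increasing family of open sets none of which contains `A`,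
then `A` contains a discrete subset whose closure leaves `A`. -/
theorem exists_discrete_closure_diff_nonempty_of_monotone_cover {X ι : Type*}
    [TopologicalSpace X] [CompactSpace X] [LinearOrder ι] [WellFoundedLT ι] [Nonempty ι]
    {A : Set X} {U : ι → Set X} (hUo : ∀ i, IsOpen (U i)) (hUm : Monotone U)
    (hcov : A ⊆ ⋃ i, U i) (hA : ∀ i, ¬ A ⊆ U i) :
    ∃ D : Set X, D ⊆ A ∧ DiscreteTopology D ∧ (closure D \ A).Nonempty := by
  obtain ⟨d, hd⟩ := exists_greedy_selection fun i => (A ∩ U i) \ ⋃ j < i, U j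
  have hdA {i x} (hx : x ∈ d i) : x ∈ A := ((hd i).2.1 hx).1.1.1
  have hdU {i x} (hx : x ∈ d i) : x ∈ U i := ((hd i).2.1 hx).1.1.2
  have hd_not {i j x} (hx : x ∈ d i) (hj : j < i) : x ∉ U j := fun h =>
    ((hd i).2.1 hx).1.2 (mem_biUnion hj h)
  have hd_cl {i x} (hx : x ∈ d i) : x ∉ closure (⋃ j < i, d j) := ((hd i).2.1 hx).2
  refine ⟨⋃ i, d i, iUnion_subset fun i x hx => hdA hx, ?_, ?_⟩
  · rw [← isDiscrete_iff_discreteTopology, isDiscrete_iff_forall_mem_exists_isOpen]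
    intro x hx
    obtain ⟨i, hi⟩ := mem_iUnion.1 hx
    refine ⟨U i \ closure (⋃ j < i, d j), (hUo i).sdiff isClosed_closure, ?_⟩
    refine Subset.antisymm ?_ (singleton_subset_iff.2 ⟨⟨hdU hi, hd_cl hi⟩, hx⟩)
    rintro y ⟨⟨hyU, hyc⟩, hy⟩
    obtain ⟨j, hj⟩ := mem_iUnion.1 hy
    rcases lt_trichotomy j i with h | rfl | h
    · exact (hyc (subset_closure (mem_biUnion h hj))).elim
    · exact (hd j).1 hj hi
    · exact (hd_not hj h hyU).elim
  · rw [sdiff_nonempty]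
    intro hcl
    obtain ⟨i, hi⟩ := isClosed_closure.isCompact.elim_directed_cover U hUo (hcl.trans hcov)
      hUm.directed_le
    obtain ⟨x, hxA, hxi⟩ := not_subset.1 (hA i)
    obtain ⟨j, hj, hmin⟩ := WellFounded.has_min (wellFounded_lt (α := ι)) {j | x ∈ U j}
      (mem_iUnion.1 (hcov hxA))
    have hij : i < j := lt_of_not_ge fun h => hxi (hUm h hj)
    obtain ⟨y, hy⟩ := (hd j).2.2 ⟨x, ⟨⟨hxA, hj⟩, by simpa using fun k hk h => hmin k h hk⟩,
      fun h => hxi (hi (closure_mono (iUnion₂_subset fun k _ => subset_iUnion d k) h))⟩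
    exact hd_not hy hij (hi (subset_closure (mem_iUnion_of_mem j hy)))

/-- A non-closed subset of a regular Hausdorff space is covered by a well-ordered increasing
family of open sets none of which contains it. -/
theorem exists_monotone_open_cover_of_not_isClosed {X : Type u} [TopologicalSpace X] [T3Space X]
    {A : Set X} (hA : ¬ IsClosed A) :
    ∃ (ι : Type u) (_ : LinearOrder ι) (_ : WellFoundedLT ι) (_ : Nonempty ι) (U : ι → Set X),
      (∀ i, IsOpen (U i)) ∧ Monotone U ∧ A ⊆ ⋃ i, U i ∧ ∀ i, ¬ A ⊆ U i := by
  obtain ⟨p, hpc, hpA⟩ : ∃ p ∈ closure A, p ∉ A := by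
    simpa [isClosed_iff_clusterPt, mem_closure_iff_clusterPt] using hA
  have hsep (b : X) : ∃ W ∈ 𝓝 p, IsClosed W ∧ (b ∈ A → b ∉ W) := by
    by_cases hb : b ∈ A
    · obtain ⟨W, hW, hWc, hWs⟩ := exists_mem_nhds_isClosed_subset
        (isOpen_ne.mem_nhds fun h : p = b => hpA (h ▸ hb))
      exact ⟨W, hW, hWc, fun _ h => hWs h rfl⟩
    · exact ⟨univ, Filter.univ_mem, isClosed_univ, fun h => (hb h).elim⟩
  choose W hWp hWc hWA using hsep
  obtain ⟨_, _⟩ := exists_wellFoundedLT X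
  let I : Set X := {b | p ∈ closure (A ∩ ⋂ c < b, W c)}
  have hI : p ∉ closure (A ∩ ⋂ c ∈ I, W c) := by
    by_cases hne : (Iᶜ).Nonempty
    · obtain ⟨m, hm, hmin⟩ := WellFounded.has_min (wellFounded_lt (α := X)) Iᶜ hne
      have hsub : ⋂ c ∈ I, W c ⊆ ⋂ c < m, W c := subset_iInter₂ fun c hc =>
        biInter_subset_of_mem (not_not.1 fun hcI => hmin c hcI hc)
      exact fun h => hm (closure_mono (inter_subset_inter_right A hsub) h)
    · rw [not_nonempty_iff_eq_empty, compl_empty_iff] at hne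
      have hempty : A ∩ ⋂ c ∈ I, W c = ∅ := eq_empty_of_forall_notMem fun x ⟨hxA, hx⟩ =>
        hWA x hxA (mem_iInter₂.1 hx x (eq_univ_iff_forall.1 hne x))
      simp [hempty]
  have hIne : I.Nonempty := by
    by_contra hne
    rw [not_nonempty_iff_eq_empty] at hne
    exact hI (by simpa [hne] using hpc)
  obtain ⟨V, hVp, hVc, hV⟩ := exists_mem_nhds_isClosed_subset
    (isClosed_closure.isOpen_compl.mem_nhds hI)
  have hmeet (b : I) : (A ∩ (V ∩ ⋂ c ≤ b.1, W c)).Nonempty := by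
    obtain ⟨x, ⟨hxV, hxW⟩, hxA, hx⟩ :=
      mem_closure_iff_nhds.1 b.2 (V ∩ W b) (Filter.inter_mem hVp (hWp b))
    refine ⟨x, hxA, hxV, mem_iInter₂.2 fun c hc => ?_⟩
    rcases hc.lt_or_eq with h | rfl
    · exact mem_iInter₂.1 hx c h
    · exact hxW
  refine ⟨I, inferInstance, inferInstance, hIne.to_subtype, fun b => (V ∩ ⋂ c ≤ b.1, W c)ᶜ, fun b => ?_,
    fun b b' h => ?_, fun x hx => ?_, fun b h => ?_⟩
  · exact (hVc.inter (isClosed_biInter fun c _ => hWc c)).isOpen_compl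
  · exact compl_subset_compl.2 (inter_subset_inter_right _
      (biInter_subset_biInter_left fun c (hc : c ≤ b.1) => hc.trans h))
  · by_contra hcon
    have hx' (b : I) : x ∈ V ∩ ⋂ c ≤ b.1, W c :=
      not_not.1 fun hb => hcon (mem_iUnion_of_mem b hb)
    exact hV (hx' ⟨_, hIne.some_mem⟩).1 (subset_closure
      ⟨hx, mem_iInter₂.2 fun c hc => mem_iInter₂.1 (hx' ⟨c, hc⟩).2 c le_rfl⟩)
  · obtain ⟨x, hxA, hx⟩ := hmeet b
    exact h hxA hx

/-- Every compact Hausdorff space is weakly discretely generated: every non-closed set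
`A` contains a discrete subset `D` whose closure meets the complement of `A`. -/
theorem compact_hausdorff_weakly_discretely_generated
    {X : Type u} [TopologicalSpace X] [CompactSpace X] [T2Space X]
    (A : Set X) (hA : ¬ IsClosed A) :
    ∃ D : Set X, D ⊆ A ∧ DiscreteTopology D ∧ (closure D \ A).Nonempty := by
  obtain ⟨ι, _, _, _, U, hUo, hUm, hcov, hU⟩ := exists_monotone_open_cover_of_not_isClosed hA
  exact exists_discrete_closure_diff_nonempty_of_monotone_cover hUo hUm hcov hU
end
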